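/- arXiv:math/0607240 — 8 statements merged into one kernel-verified Lean document; each statement's English description precedes it below -/
import Mathlib

section
/- Let n ≥ 1 and let k be an integer with 1 ≤ k ≤ n. For any real symmetric n×n matrices A and B with λ(A) ∈ Γ_k and λ(B) ∈ Γ*_k, one has ρ_k(A) · ρ*_k(B) ≤ (1/n) tr(AB). -/
open MeasureTheory Metric Set Bornology
open scoped ENNReal

noncomputable section

/-- Euclidean n-space. -/
abbrev En (n : ℕ) : Type := EuclideanSpace ℝ (Fin n)

/-- k-th elementary symmetric function of `lam : Fin n → ℝ`. -/
def esymm (n k : ℕ) (lam : Fin n → ℝ) : ℝ :=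
  ∑ s ∈ Finset.powersetCard k (Finset.univ : Finset (Fin n)), ∏ i ∈ s, lam i

/-- The open cone Γ_k = {λ : S_j(λ) > 0, j = 1,…,k}. -/
def Gamma (n k : ℕ) : Set (Fin n → ℝ) :=
  {lam | ∀ j : ℕ, 1 ≤ j → j ≤ k → 0 < esymm n j lam}

/-- The closed cone Γ̄_k = {λ : S_j(λ) ≥ 0, j = 1,…,k}. -/
def GammaBar (n k : ℕ) : Set (Fin n → ℝ) :=
  {lam | ∀ j : ℕ, 1 ≤ j → j ≤ k → 0 ≤ esymm n j lam}

/-- The dual cone Γ*_k = {λ : λ·μ ≥ 0 for all μ ∈ Γ_k}. -/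
def GammaStar (n k : ℕ) : Set (Fin n → ℝ) :=
  {lam | ∀ mu ∈ Gamma n k, 0 ≤ ∑ i, lam i * mu i}

/-- Normalized symmetric function ρ_k(λ) = (S_k(λ)/C(n,k))^(1/k). -/
def rho (n k : ℕ) (lam : Fin n → ℝ) : ℝ :=
  (esymm n k lam / (n.choose k : ℝ)) ^ ((1 : ℝ) / k)

/-- Dual function ρ*_k(λ) = inf{λ·μ/n : μ ∈ Γ_k, ρ_k(μ) ≥ 1}. -/
def rhoStar (n k : ℕ) (lam : Fin n → ℝ) : ℝ :=
  sInf {t : ℝ | ∃ mu ∈ Gamma n k, 1 ≤ rho n k mu ∧ t = (∑ i, lam i * mu i) / n}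

open Classical in
/-- Eigenvalue vector λ(A) of a (symmetric) matrix, junk value otherwise. -/
def eigs (n : ℕ) (A : Matrix (Fin n) (Fin n) ℝ) : Fin n → ℝ :=
  if h : A.IsHermitian then h.eigenvalues else 0

/-- Hessian matrix D²u of `u` at `x`. -/
def hess (n : ℕ) (u : En n → ℝ) (x : En n) : Matrix (Fin n) (Fin n) ℝ :=
  Matrix.of fun i j =>
    iteratedFDeriv ℝ 2 u x ![EuclideanSpace.single i 1, EuclideanSpace.single j 1]

/-- The k-Hessian operator F_k[u] = S_k(λ(D²u)). -/
def Fk (n k : ℕ) (u : En n → ℝ) (x : En n) : ℝ :=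
  esymm n k (eigs n (hess n u x))

/-- `u` is k-convex on `Ω`: D²u(x) ∈ Γ̄_k for all x ∈ Ω. -/
def kConvexOn (n k : ℕ) (Ω : Set (En n)) (u : En n → ℝ) : Prop :=
  ∀ x ∈ Ω, (hess n u x).IsHermitian ∧ eigs n (hess n u x) ∈ GammaBar n k

/-- Lower k-contact set Ω⁻_k of `u` in `Ω`. -/
def lowerContact (n k : ℕ) (Ω : Set (En n)) (u : En n → ℝ) : Set (En n) :=
  {x ∈ Ω | ∃ v : En n → ℝ, ContDiffOn ℝ 2 v Ω ∧ kConvexOn n k Ω v ∧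
    (∀ z ∈ Ω, v z ≤ u z) ∧ v x = u x}

/-- Upper k-contact set Ω⁺_k of `u` in `Ω`. -/
def upperContact (n k : ℕ) (Ω : Set (En n)) (u : En n → ℝ) : Set (En n) :=
  {x ∈ Ω | ∃ w : En n → ℝ, ContDiffOn ℝ 2 w Ω ∧ kConvexOn n k Ω (fun z => -w z) ∧
    (∀ z ∈ Ω, u z ≤ w z) ∧ w x = u x}

/-- The elementary symmetric functions are homogeneous. -/
lemma esymm_smul (n k : ℕ) (c : ℝ) (lam : Fin n → ℝ) :
    esymm n k (c • lam) = c ^ k * esymm n k lam := by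
  simp only [esymm, Finset.mul_sum]
  refine Finset.sum_congr rfl fun s hs => ?_
  simp [Finset.prod_mul_distrib, (Finset.mem_powersetCard.mp hs).2]

/-- The elementary symmetric functions are invariant under permutations. -/
lemma esymm_comp_perm (n k : ℕ) (σ : Equiv.Perm (Fin n)) (lam : Fin n → ℝ) :
    esymm n k (lam ∘ σ) = esymm n k lam := by
  unfold esymm
  refine Finset.sum_equiv σ.finsetCongr (fun s => ?_) (fun s _ => ?_)
  · simp [Finset.mem_powersetCard]
  · simp

lemma comp_perm_mem_Gamma {n k : ℕ} (σ : Equiv.Perm (Fin n)) {lam : Fin n → ℝ}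
    (h : lam ∈ Gamma n k) : lam ∘ σ ∈ Gamma n k := fun j h1 h2 => by
  rw [esymm_comp_perm]
  exact h j h1 h2

lemma smul_mem_Gamma {n k : ℕ} {c : ℝ} (hc : 0 < c) {lam : Fin n → ℝ}
    (h : lam ∈ Gamma n k) : c • lam ∈ Gamma n k := fun j h1 h2 => by
  rw [esymm_smul]
  exact mul_pos (pow_pos hc j) (h j h1 h2)

lemma rho_comp_perm (n k : ℕ) (σ : Equiv.Perm (Fin n)) (lam : Fin n → ℝ) :
    rho n k (lam ∘ σ) = rho n k lam := by
  rw [rho, esymm_comp_perm, rho]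

lemma rho_pos {n k : ℕ} (hk1 : 1 ≤ k) (hkn : k ≤ n) {lam : Fin n → ℝ}
    (h : lam ∈ Gamma n k) : 0 < rho n k lam :=
  Real.rpow_pos_of_pos
    (div_pos (h k hk1 le_rfl) (Nat.cast_pos.mpr (Nat.choose_pos hkn))) _

lemma rho_smul {n k : ℕ} (hk1 : 1 ≤ k) {c : ℝ} (hc : 0 ≤ c) {lam : Fin n → ℝ}
    (h : lam ∈ Gamma n k) : rho n k (c • lam) = c * rho n k lam := by
  have hlam : 0 ≤ esymm n k lam / (n.choose k : ℝ) :=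
    div_nonneg (h k hk1 le_rfl).le (Nat.cast_nonneg _)
  rw [rho, esymm_smul, mul_div_assoc, Real.mul_rpow (pow_nonneg hc k) hlam, one_div,
    Real.pow_rpow_inv_natCast hc (by omega), rho, one_div]

/-- The vector version of the duality inequality. -/
lemma rho_mul_rhoStar_le_dot {n k : ℕ} (hk1 : 1 ≤ k) (hkn : k ≤ n)
    {lam mu : Fin n → ℝ} (hlam : lam ∈ Gamma n k) (hmu : mu ∈ GammaStar n k) :
    rho n k lam * rhoStar n k mu ≤ (∑ i, mu i * lam i) / n := by
  have hr := rho_pos hk1 hkn hlam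
  have hle : rhoStar n k mu ≤ (∑ i, mu i * ((rho n k lam)⁻¹ • lam) i) / n := by
    refine csInf_le ⟨0, ?_⟩
      ⟨_, smul_mem_Gamma (inv_pos.mpr hr) hlam, ?_, rfl⟩
    · rintro t ⟨nu, hnu, -, rfl⟩
      exact div_nonneg (hmu nu hnu) (Nat.cast_nonneg n)
    · rw [rho_smul hk1 (inv_pos.mpr hr).le hlam, inv_mul_cancel₀ hr.ne']
  calc rho n k lam * rhoStar n k mu
      ≤ rho n k lam * ((∑ i, mu i * ((rho n k lam)⁻¹ • lam) i) / n) :=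
        mul_le_mul_of_nonneg_left hle hr.le
    _ = (∑ i, mu i * lam i) / n := by
        simp only [Pi.smul_apply, smul_eq_mul, mul_left_comm _ (rho n k lam)⁻¹,
          ← Finset.mul_sum]
        field_simp

/-- A lower bound for `mu · (lam ∘ σ)` over all permutations `σ` is also a lower bound for
`mu · M lam` over all doubly stochastic matrices `M`. -/
lemma le_dotProduct_mulVec_of_mem_doublyStochastic {ι : Type*} [Fintype ι] [DecidableEq ι]
    {M : Matrix ι ι ℝ} (hM : M ∈ doublyStochastic ℝ ι) {lam mu : ι → ℝ} {c : ℝ}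
    (h : ∀ σ : Equiv.Perm ι, c ≤ mu ⬝ᵥ (lam ∘ σ)) : c ≤ mu ⬝ᵥ M.mulVec lam := by
  obtain ⟨w, hw0, hw1, rfl⟩ := exists_eq_sum_perm_of_mem_doublyStochastic hM
  rw [Matrix.sum_mulVec, dotProduct_sum, ← one_mul c, ← hw1, Finset.sum_mul]
  refine Finset.sum_le_sum fun σ _ => ?_
  rw [Matrix.smul_mulVec, dotProduct_smul, smul_eq_mul, Matrix.permMatrix_mulVec]
  exact mul_le_mul_of_nonneg_left (h σ) (hw0 σ)

/-- The entrywise square of a real orthogonal matrix is doubly stochastic. -/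
lemma sq_mem_doublyStochastic {ι : Type*} [Fintype ι] [DecidableEq ι]
    {W : Matrix ι ι ℝ} (hW : W ∈ Matrix.unitaryGroup ι ℝ) :
    (Matrix.of fun i j => W i j ^ 2) ∈ doublyStochastic ℝ ι := by
  rw [mem_doublyStochastic_iff_sum]
  refine ⟨fun i j => sq_nonneg _, fun i => ?_, fun j => ?_⟩
  · have := congrFun (congrFun (Matrix.mem_unitaryGroup_iff.mp hW) i) i
    simpa [Matrix.mul_apply, Matrix.star_apply, sq] using this
  · have := congrFun (congrFun (Matrix.mem_unitaryGroup_iff'.mp hW) j) j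
    simpa [Matrix.mul_apply, Matrix.star_apply, sq] using this

/-- The Frobenius inner product of two real symmetric matrices is given by their eigenvalues and
a doubly stochastic matrix. -/
lemma exists_doublyStochastic_frobenius {ι : Type*} [Fintype ι] [DecidableEq ι]
    {A B : Matrix ι ι ℝ} (hA : A.IsHermitian) (hB : B.IsHermitian) :
    ∃ M ∈ doublyStochastic ℝ ι,
      ∑ i, ∑ j, A i j * B i j = hB.eigenvalues ⬝ᵥ M.mulVec hA.eigenvalues := by
  set U := hA.eigenvectorUnitary
  set V := hB.eigenvectorUnitary
  set W : Matrix.unitaryGroup ι ℝ := star V * U with hW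
  refine ⟨_, sq_mem_doublyStochastic W.2, ?_⟩
  have htr : ∑ i, ∑ j, A i j * B i j = (A * B).trace := by
    simp only [Matrix.trace, Matrix.diag, Matrix.mul_apply]
    refine Finset.sum_congr rfl fun i _ => Finset.sum_congr rfl fun j _ => ?_
    rw [← hB.apply j i, star_trivial]
  have hAe : A = (U : Matrix ι ι ℝ) * Matrix.diagonal hA.eigenvalues * star (U : Matrix ι ι ℝ) := by
    simpa [Unitary.conjStarAlgAut_apply] using hA.spectral_theorem
  have hBe : B = (V : Matrix ι ι ℝ) * Matrix.diagonal hB.eigenvalues * star (V : Matrix ι ι ℝ) := by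
    simpa [Unitary.conjStarAlgAut_apply] using hB.spectral_theorem
  have hWc : (W : Matrix ι ι ℝ) = star (V : Matrix ι ι ℝ) * U := rfl
  have hcyc : (A * B).trace = (Matrix.diagonal hB.eigenvalues *
      ((W : Matrix ι ι ℝ) * (Matrix.diagonal hA.eigenvalues * star (W : Matrix ι ι ℝ)))).trace := by
    conv_lhs => rw [hAe, hBe]
    rw [hWc, star_mul, star_star, Matrix.trace_mul_comm]
    simp only [Matrix.mul_assoc]
    rw [Matrix.trace_mul_comm]
    simp only [Matrix.mul_assoc]
  rw [htr, hcyc]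
  simp only [Matrix.trace, Matrix.diag, Matrix.diagonal_mul, dotProduct, Matrix.mulVec,
    Matrix.mul_apply (M := (W : Matrix ι ι ℝ)), Matrix.of_apply, Matrix.star_apply, star_trivial]
  refine Finset.sum_congr rfl fun i _ => ?_
  congr 1
  exact Finset.sum_congr rfl fun j _ => by ring

/-- Proposition 2.1: ρ_k(A) ρ*_k(B) ≤ (1/n) tr(AB) for A ∈ Γ_k, B ∈ Γ*_k. -/
theorem rho_mul_rhoStar_le_inner (n k : ℕ) (hn : 1 ≤ n) (hk1 : 1 ≤ k) (hkn : k ≤ n)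
    (A B : Matrix (Fin n) (Fin n) ℝ) (hA : A.IsHermitian) (hB : B.IsHermitian)
    (hAg : hA.eigenvalues ∈ Gamma n k) (hBg : hB.eigenvalues ∈ GammaStar n k) :
    rho n k hA.eigenvalues * rhoStar n k hB.eigenvalues ≤
      (1 / (n : ℝ)) * ∑ i, ∑ j, A i j * B i j := by
  obtain ⟨M, hM, hMeq⟩ := exists_doublyStochastic_frobenius hA hB
  have hn0 : (0 : ℝ) < n := Nat.cast_pos.mpr hn
  rw [hMeq, one_div, ← div_eq_inv_mul, le_div_iff₀ hn0]
  refine le_dotProduct_mulVec_of_mem_doublyStochastic hM fun σ => ?_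
  rw [← le_div_iff₀ hn0, ← rho_comp_perm n k σ]
  exact rho_mul_rhoStar_le_dot hk1 hkn (comp_perm_mem_Gamma σ hAg) hBg

end
end

section
/- Let n ≥ 2, let k be an integer with 1 ≤ k ≤ n, and let Ω ⊂ ℝ^n be a bounded domain. Suppose u, u₀ ∈ C⁰(cl Ω) ∩ C²(Ω), u₀ is k-convex in Ω, F_k[u₀](x) > F_k[u](x) for every x in the lower k-contact set Ω⁻_k of u, and u₀ ≤ u on ∂Ω. Then u₀ ≤ u throughout Ω. -/
open MeasureTheory Metric Set Bornology
open scoped ENNReal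

noncomputable section

/-- The derivative of a real polynomial that splits also splits. -/
theorem splits_derivative_real {p : Polynomial ℝ} (hp : p.Splits) :
    (Polynomial.derivative p).Splits := by
  rcases Nat.eq_zero_or_pos p.natDegree with h0 | hpos
  · rw [Polynomial.derivative_of_natDegree_zero h0]
    exact Polynomial.Splits.zero
  · rw [Polynomial.splits_iff_card_roots]
    have h1 := Polynomial.card_roots_le_derivative p
    have h2 := Polynomial.card_roots' (Polynomial.derivative p)
    have h3 := Polynomial.natDegree_derivative_lt hpos.ne'
    rw [← hp.natDegree_eq_card_roots] at h1
    omega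

theorem two_mul_coeff_zero_mul_coeff_two_le {p : Polynomial ℝ} (hp : p.Splits) :
    2 * (p.coeff 0 * p.coeff 2) ≤ p.coeff 1 ^ 2 := by
  obtain ⟨m, hm⟩ := Polynomial.splits_iff_exists_multiset'.1 hp
  rw [hm]
  suffices h : 2 * ((m.map (Polynomial.X + Polynomial.C ·)).prod.coeff 0 *
      (m.map (Polynomial.X + Polynomial.C ·)).prod.coeff 2) ≤
      (m.map (Polynomial.X + Polynomial.C ·)).prod.coeff 1 ^ 2 by
    simp only [Polynomial.coeff_C_mul]
    nlinarith [mul_le_mul_of_nonneg_left h (sq_nonneg p.leadingCoeff)]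
  clear hm
  induction m using Multiset.induction_on with
  | empty => simp [Polynomial.coeff_one]
  | cons a m ih =>
    rw [Multiset.map_cons, Multiset.prod_cons]
    set q := (m.map (Polynomial.X + Polynomial.C ·)).prod
    simp only [add_mul, Polynomial.coeff_add, Polynomial.coeff_C_mul, Polynomial.coeff_X_mul,
      Polynomial.coeff_X_mul_zero]
    nlinarith [mul_le_mul_of_nonneg_left ih (sq_nonneg a), sq_nonneg (q.coeff 0)]

/-- **Newton's inequality** for the coefficients of a real-rooted polynomial. -/
theorem newton_coeff_le {p : Polynomial ℝ} (hp : p.Splits) (m : ℕ) :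
    ((m : ℝ) + 2) * (p.coeff m * p.coeff (m + 2)) ≤ (m + 1) * p.coeff (m + 1) ^ 2 := by
  induction m generalizing p with
  | zero => simpa using two_mul_coeff_zero_mul_coeff_two_le hp
  | succ m ih =>
    have h := ih (splits_derivative_real hp)
    simp only [Polynomial.coeff_derivative] at h
    push_cast at h ⊢
    have hpos : (0 : ℝ) < (m + 1) * (m + 2) := by positivity
    refine le_of_mul_le_mul_left ?_ hpos
    convert! h using 1 <;> ring

/-- If a product `(1 + c X) q` with `q` real-rooted and `q 0 = 1` has nonnegative coefficients up to
degree `k`, then `q` has nonnegative coefficients up to degree `k - 1`. -/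
theorem coeff_nonneg_of_coeff_mul_nonneg {q : Polynomial ℝ} (hq : q.Splits) (hq0 : q.coeff 0 = 1)
    (c : ℝ) (k : ℕ)
    (h : ∀ j, j < k → 0 ≤ q.coeff (j + 1) + c * q.coeff j) :
    ∀ j, j < k → 0 ≤ q.coeff j := by
  intro j
  induction j with
  | zero => intro _; rw [hq0]; exact zero_le_one
  | succ j ih =>
    intro hj
    have hj0 := ih (by omega)
    have h1 := h j (by omega)
    have h2 := h (j + 1) hj
    by_contra! hneg
    have hN := newton_coeff_le hq j
    rcases le_or_gt c 0 with hc | hc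
    · nlinarith [mul_nonneg (neg_nonneg.2 hc) hj0]
    · have ha : -q.coeff (j + 1) ≤ c * q.coeff j := by linarith
      have hb : c * -q.coeff (j + 1) ≤ q.coeff (j + 2) := by linarith
      have hx : 0 < -q.coeff (j + 1) := by linarith
      have hmul : q.coeff (j + 1) ^ 2 ≤ q.coeff j * q.coeff (j + 2) := by
        nlinarith [mul_le_mul_of_nonneg_right ha hx.le, mul_le_mul_of_nonneg_left hb hj0]
      have hsq : 0 < q.coeff (j + 1) ^ 2 := by nlinarith
      have hm : (0 : ℝ) ≤ j := Nat.cast_nonneg j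
      nlinarith [mul_le_mul_of_nonneg_left hmul (by linarith : (0 : ℝ) ≤ j + 2)]

/-- The generating polynomial `∏ (1 + λᵢ X)` of the elementary symmetric functions. -/
def esymmPoly {n : ℕ} (s : Finset (Fin n)) (lam : Fin n → ℝ) : Polynomial ℝ :=
  ∏ i ∈ s, (1 + Polynomial.C (lam i) * Polynomial.X)

theorem esymmPoly_coeff (n j : ℕ) (lam : Fin n → ℝ) :
    (esymmPoly Finset.univ lam).coeff j = esymm n j lam := by
  unfold esymmPoly esymm
  rw [Finset.prod_one_add, Polynomial.finsetSum_coeff, Finset.powersetCard_eq_filter,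
    Finset.sum_filter]
  refine Finset.sum_congr rfl fun t _ => ?_
  rw [Finset.prod_mul_distrib, Finset.prod_const, ← map_prod, Polynomial.coeff_C_mul_X_pow]
  simp only [eq_comm]

theorem esymmPoly_splits {n : ℕ} (s : Finset (Fin n)) (lam : Fin n → ℝ) :
    (esymmPoly s lam).Splits := by
  refine Polynomial.Splits.prod fun i _ => ?_
  apply Polynomial.Splits.of_natDegree_le_one
  compute_degree

theorem esymmPoly_coeff_zero {n : ℕ} (s : Finset (Fin n)) (lam : Fin n → ℝ) :
    (esymmPoly s lam).coeff 0 = 1 := by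
  rw [esymmPoly, Polynomial.coeff_zero_prod]
  simp

theorem esymmPoly_eval {n : ℕ} (s : Finset (Fin n)) (lam : Fin n → ℝ) (t : ℝ) :
    (esymmPoly s lam).eval t = ∏ i ∈ s, (1 + lam i * t) := by
  simp [esymmPoly, Polynomial.eval_prod]

theorem esymmPoly_erase_coeff_nonneg {n k : ℕ} {lam : Fin n → ℝ} (h : lam ∈ GammaBar n k)
    (i : Fin n) (j : ℕ) (hj : j < k) :
    0 ≤ (esymmPoly (Finset.univ.erase i) lam).coeff j := by
  refine coeff_nonneg_of_coeff_mul_nonneg (esymmPoly_splits _ _) (esymmPoly_coeff_zero _ _)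
    (lam i) k (fun l hl => ?_) j hj
  have h1 := h (l + 1) (by omega) (by omega)
  rw [← esymmPoly_coeff, esymmPoly, ← Finset.mul_prod_erase _ _ (Finset.mem_univ i), add_mul,
    one_mul, Polynomial.coeff_add, mul_assoc, Polynomial.coeff_C_mul, Polynomial.coeff_X_mul] at h1
  exact h1

open Matrix in
theorem det_diagonal_add_vecMulVec {n : ℕ} (d w : Fin n → ℝ) (c : ℝ) (hd : ∀ i, d i ≠ 0) :
    (diagonal d + c • vecMulVec w w).det =
      ∏ i, d i + c * ∑ i, w i ^ 2 * ∏ l ∈ Finset.univ.erase i, d l := by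
  have hprod : (diagonal d).det ≠ 0 := by
    rw [det_diagonal]
    exact Finset.prod_ne_zero_iff.2 fun i _ => hd i
  have hinv : (diagonal d)⁻¹ = diagonal (fun i => (d i)⁻¹) := by
    apply inv_eq_right_inv
    rw [diagonal_mul_diagonal, ← diagonal_one]
    congr 1
    funext i
    exact mul_inv_cancel₀ (hd i)
  rw [← smul_vecMulVec, vecMulVec_eq Unit,
    det_add_replicateCol_mul_replicateRow (isUnit_iff_ne_zero.2 hprod), det_diagonal, hinv,
    Matrix.mul_assoc, det_unique, Matrix.add_apply, one_apply_eq, mul_add, mul_one]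
  congr 1
  simp only [Matrix.mul_apply, replicateRow_apply, diagonal_apply, replicateCol_apply, ite_mul,
    zero_mul, Finset.sum_ite_eq, Finset.mem_univ, if_true, Finset.mul_sum, Pi.smul_apply,
    smul_eq_mul]
  refine Finset.sum_congr rfl fun i _ => ?_
  rw [← Finset.mul_prod_erase _ _ (Finset.mem_univ i)]
  field_simp [hd i]

open Matrix in
theorem det_one_add_smul_conj {n : ℕ} {U V : Matrix (Fin n) (Fin n) ℝ} (hUV : U * V = 1)
    (M : Matrix (Fin n) (Fin n) ℝ) (t : ℝ) : (1 + t • (U * M * V)).det = (1 + t • M).det := by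
  have hVU : V * U = 1 := mul_eq_one_comm.1 hUV
  have h : 1 + t • (U * M * V) = U * (1 + t • M) * V := by
    rw [Matrix.mul_add, Matrix.add_mul, Matrix.mul_one, hUV, Matrix.mul_smul, Matrix.smul_mul]
  rw [h, det_mul_comm, ← Matrix.mul_assoc, hVU, Matrix.one_mul]

open Matrix in
theorem exists_diagonalization {n : ℕ} {A : Matrix (Fin n) (Fin n) ℝ} (hA : A.IsHermitian) :
    ∃ U : Matrix (Fin n) (Fin n) ℝ, U * Uᵀ = 1 ∧ A = U * diagonal (eigs n A) * Uᵀ := by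
  refine ⟨hA.eigenvectorUnitary, ?_, ?_⟩
  · exact Unitary.coe_mul_star_self hA.eigenvectorUnitary
  · conv_lhs => rw [hA.spectral_theorem, Unitary.conjStarAlgAut_apply]
    rw [eigs, dif_pos hA]
    rfl

open Matrix in
theorem esymmPoly_eigs_eval {n : ℕ} {A : Matrix (Fin n) (Fin n) ℝ} (hA : A.IsHermitian) (t : ℝ) :
    (esymmPoly Finset.univ (eigs n A)).eval t = (1 + t • A).det := by
  obtain ⟨U, hU, hAU⟩ := exists_diagonalization hA
  conv_rhs => rw [hAU, det_one_add_smul_conj hU]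
  rw [esymmPoly_eval, ← diagonal_one, ← diagonal_smul, diagonal_add, det_diagonal]
  simp [mul_comm]

open Matrix in
theorem exists_esymmPoly_add_vecMulVec {n : ℕ} {A : Matrix (Fin n) (Fin n) ℝ}
    (hA : A.IsHermitian) (v : Fin n → ℝ) : ∃ w : Fin n → ℝ,
    esymmPoly Finset.univ (eigs n (A + vecMulVec v v)) = esymmPoly Finset.univ (eigs n A) +
      Polynomial.X * ∑ i, Polynomial.C (w i ^ 2) *
        esymmPoly (Finset.univ.erase i) (eigs n A) := by
  obtain ⟨U, hU, hAU⟩ := exists_diagonalization hA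
  have hB : (A + vecMulVec v v).IsHermitian :=
    hA.add (posSemidef_vecMulVec_self_star v).isHermitian
  have hP : esymmPoly Finset.univ (eigs n A) ≠ 0 := by
    intro h
    have := esymmPoly_coeff_zero Finset.univ (eigs n A)
    simp [h] at this
  refine ⟨Uᵀ *ᵥ v, mul_left_cancel₀ hP (Polynomial.funext fun t => ?_)⟩
  rw [Polynomial.eval_mul, Polynomial.eval_mul]
  by_cases ht : (esymmPoly Finset.univ (eigs n A)).eval t = 0
  · rw [ht, zero_mul, zero_mul]
  congr 1
  have hd : ∀ i, 1 + eigs n A i * t ≠ 0 := by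
    rw [esymmPoly_eval] at ht
    exact fun i => Finset.prod_ne_zero_iff.1 ht i (Finset.mem_univ i)
  have hv : vecMulVec v v = U * vecMulVec (Uᵀ *ᵥ v) (Uᵀ *ᵥ v) * Uᵀ := by
    rw [mul_vecMulVec, vecMulVec_mul, vecMul_transpose, mulVec_mulVec, hU, one_mulVec]
  have hsum : A + vecMulVec v v =
      U * (diagonal (eigs n A) + vecMulVec (Uᵀ *ᵥ v) (Uᵀ *ᵥ v)) * Uᵀ := by
    rw [Matrix.mul_add, Matrix.add_mul, ← hv, ← hAU]
  have hdiag : 1 + t • (diagonal (eigs n A) + vecMulVec (Uᵀ *ᵥ v) (Uᵀ *ᵥ v)) =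
      diagonal (fun i => 1 + eigs n A i * t) + t • vecMulVec (Uᵀ *ᵥ v) (Uᵀ *ᵥ v) := by
    rw [smul_add, ← add_assoc, ← diagonal_one, ← diagonal_smul, diagonal_add]
    congr 2
    funext i
    simp [mul_comm]
  rw [esymmPoly_eigs_eval hB]
  conv_lhs => rw [hsum, det_one_add_smul_conj hU, hdiag, det_diagonal_add_vecMulVec _ _ _ hd]
  simp only [Polynomial.eval_add, Polynomial.eval_mul, Polynomial.eval_X, Polynomial.eval_C,
    Polynomial.eval_finsetSum, esymmPoly_eval]

open Matrix in
theorem esymm_eigs_le_add_vecMulVec {n k : ℕ} {A : Matrix (Fin n) (Fin n) ℝ}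
    (hA : A.IsHermitian) (hk : eigs n A ∈ GammaBar n k) (v : Fin n → ℝ) {j : ℕ} (hj1 : 1 ≤ j)
    (hjk : j ≤ k) : esymm n j (eigs n A) ≤ esymm n j (eigs n (A + vecMulVec v v)) := by
  obtain ⟨w, hw⟩ := exists_esymmPoly_add_vecMulVec hA v
  obtain ⟨l, rfl⟩ : ∃ l, j = l + 1 := ⟨j - 1, by omega⟩
  rw [← esymmPoly_coeff, ← esymmPoly_coeff, hw, Polynomial.coeff_add, Polynomial.coeff_X_mul,
    Polynomial.finsetSum_coeff]
  refine le_add_of_nonneg_right (Finset.sum_nonneg fun i _ => ?_)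
  rw [Polynomial.coeff_C_mul]
  exact mul_nonneg (sq_nonneg _) (esymmPoly_erase_coeff_nonneg hk i l (by omega))

open Matrix in
/-- Monotonicity of `S_k` with respect to the Loewner order on `Γ̄_k`. -/
theorem esymm_eigs_le_of_posSemidef {n k : ℕ} {A B : Matrix (Fin n) (Fin n) ℝ}
    (hA : A.IsHermitian) (hAk : eigs n A ∈ GammaBar n k) (hAB : (B - A).PosSemidef)
    (hk1 : 1 ≤ k) : esymm n k (eigs n A) ≤ esymm n k (eigs n B) := by
  obtain ⟨m, v, hv⟩ := posSemidef_iff_eq_sum_vecMulVec.1 hAB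
  have key : ∀ s : Finset (Fin m), (A + ∑ i ∈ s, vecMulVec (v i) (v i)).IsHermitian ∧
      eigs n (A + ∑ i ∈ s, vecMulVec (v i) (v i)) ∈ GammaBar n k ∧
      esymm n k (eigs n A) ≤ esymm n k (eigs n (A + ∑ i ∈ s, vecMulVec (v i) (v i))) := by
    intro s
    induction s using Finset.induction_on with
    | empty => simpa using ⟨hA, hAk⟩
    | insert a s ha ih =>
      obtain ⟨h1, h2, h3⟩ := ih
      rw [Finset.sum_insert ha, add_comm (vecMulVec (v a) (v a)), ← add_assoc]
      exact ⟨h1.add (posSemidef_vecMulVec_self_star (v a)).isHermitian,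
        fun j hj1 hjk => (h2 j hj1 hjk).trans (esymm_eigs_le_add_vecMulVec h1 h2 _ hj1 hjk),
        h3.trans (esymm_eigs_le_add_vecMulVec h1 h2 _ hk1 le_rfl)⟩
  have hB : B = A + ∑ i, vecMulVec (v i) (v i) := by
    rw [eq_comm, ← eq_sub_iff_add_eq', hv]
    simp
  rw [hB]
  exact (key Finset.univ).2.2

theorem fderiv_fderiv_nonneg_of_isLocalMin {E : Type*} [NormedAddCommGroup E] [NormedSpace ℝ E]
    {w : E → ℝ} {x : E} (hw : ContDiffAt ℝ 2 w x) (hmin : IsLocalMin w x) (v : E) :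
    0 ≤ fderiv ℝ (fderiv ℝ w) x v v := by
  have hline : ∀ t : ℝ, HasDerivAt (fun t : ℝ => x + t • v) v t := fun t => by
    simpa using ((hasDerivAt_id t).smul_const v).const_add x
  have htend : Filter.Tendsto (fun t : ℝ => x + t • v) (nhds 0) (nhds x) := by
    simpa using (hline 0).continuousAt.tendsto
  have hderiv : deriv (fun t : ℝ => w (x + t • v)) =ᶠ[nhds 0]
      fun t => fderiv ℝ w (x + t • v) v := by
    filter_upwards [htend.eventually (hw.eventually (by simp))] with t ht
    exact ((ht.differentiableAt (by simp)).hasFDerivAt.comp_hasDerivAt t (hline t)).deriv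
  have hderiv2 : deriv (deriv (fun t : ℝ => w (x + t • v))) 0 = fderiv ℝ (fderiv ℝ w) x v v := by
    rw [hderiv.deriv_eq]
    have hd : HasFDerivAt (fderiv ℝ w) (fderiv ℝ (fderiv ℝ w) x) (x + (0 : ℝ) • v) := by
      rw [zero_smul, add_zero]
      exact ((hw.fderiv_right (m := 1) (by norm_num)).differentiableAt (by simp)).hasFDerivAt
    have h1 := hd.comp_hasDerivAt (0 : ℝ) (hline 0)
    simpa using (h1.clm_apply (hasDerivAt_const (0 : ℝ) v)).deriv
  have hmin' : IsLocalMin (fun t : ℝ => w (x + t • v)) 0 := by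
    filter_upwards [htend.eventually hmin] with t ht
    simpa using ht
  by_contra! hneg
  rw [← hderiv2] at hneg
  have hcont : ContinuousAt (fun t : ℝ => w (x + t • v)) 0 :=
    ContinuousAt.comp' (by simpa using hw.continuousAt) (hline 0).continuousAt
  have hmax := isLocalMax_of_deriv_deriv_neg hneg hmin'.deriv_eq_zero hcont
  have hconst : (fun t : ℝ => w (x + t • v)) =ᶠ[nhds 0] fun _ => w (x + (0 : ℝ) • v) := by
    filter_upwards [hmin', hmax] with t h1 h2
    exact le_antisymm h2 h1
  rw [hconst.deriv.deriv_eq] at hneg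
  simp at hneg

theorem hess_apply {n : ℕ} (u : En n → ℝ) (x : En n) (i j : Fin n) :
    hess n u x i j = fderiv ℝ (fderiv ℝ u) x (EuclideanSpace.single i 1)
      (EuclideanSpace.single j 1) := by
  simp [hess, iteratedFDeriv_two_apply]

theorem hess_isHermitian {n : ℕ} {u : En n → ℝ} {x : En n} (hu : ContDiffAt ℝ 2 u x) :
    (hess n u x).IsHermitian := by
  ext i j
  rw [Matrix.conjTranspose_apply, hess_apply, hess_apply]
  exact hu.isSymmSndFDerivAt (by simp) _ _

theorem hess_sub {n : ℕ} {u v : En n → ℝ} {x : En n} (hu : ContDiffAt ℝ 2 u x)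
    (hv : ContDiffAt ℝ 2 v x) : hess n (fun z => u z - v z) x = hess n u x - hess n v x := by
  have h : fderiv ℝ (fun z => u z - v z) =ᶠ[nhds x] fun z => fderiv ℝ u z - fderiv ℝ v z := by
    filter_upwards [hu.eventually (by simp), hv.eventually (by simp)] with z h1 h2
    exact fderiv_fun_sub (h1.differentiableAt (by simp)) (h2.differentiableAt (by simp))
  have hu' := (hu.fderiv_right (m := 1) (by norm_num)).differentiableAt (by simp)
  have hv' := (hv.fderiv_right (m := 1) (by norm_num)).differentiableAt (by simp)
  ext i j
  rw [Matrix.sub_apply, hess_apply, hess_apply, hess_apply, h.fderiv_eq, fderiv_fun_sub hu' hv']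
  rfl

theorem hess_sub_const {n : ℕ} (u : En n → ℝ) (c : ℝ) (x : En n) :
    hess n (fun z => u z - c) x = hess n u x := by
  ext i j
  have h : fderiv ℝ (fun z => u z - c) = fderiv ℝ u := funext fun z => fderiv_sub_const c
  rw [hess_apply, hess_apply, h]

open Matrix in
theorem dotProduct_hess_mulVec {n : ℕ} (u : En n → ℝ) (x : En n) (y : Fin n → ℝ) :
    y ⬝ᵥ (hess n u x *ᵥ y) =
      fderiv ℝ (fderiv ℝ u) x (WithLp.toLp 2 y) (WithLp.toLp 2 y) := by
  have hy : WithLp.toLp 2 y = ∑ i, y i • (EuclideanSpace.single i (1 : ℝ) : En n) := by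
    ext j
    simp [Pi.single_apply]
  simp only [hy, map_sum, map_smul, _root_.sum_apply, _root_.smul_apply, dotProduct, mulVec,
    hess_apply, smul_eq_mul, Finset.mul_sum]
  rw [Finset.sum_comm]
  refine Finset.sum_congr rfl fun j _ => Finset.sum_congr rfl fun i _ => ?_
  ring

theorem hess_posSemidef_of_isLocalMin {n : ℕ} {w : En n → ℝ} {x : En n}
    (hw : ContDiffAt ℝ 2 w x) (hmin : IsLocalMin w x) : (hess n w x).PosSemidef := by
  refine Matrix.PosSemidef.of_dotProduct_mulVec_nonneg (hess_isHermitian hw) fun y => ?_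
  rw [star_trivial, dotProduct_hess_mulVec]
  exact fderiv_fderiv_nonneg_of_isLocalMin hw hmin _

/-- Comparison principle via the lower k-contact set. -/
theorem comparison_principle (n k : ℕ) (hn : 2 ≤ n) (hk1 : 1 ≤ k) (hkn : k ≤ n)
    (Ω : Set (En n)) (hΩo : IsOpen Ω) (hΩb : IsBounded Ω) (hΩc : IsConnected Ω)
    (u u₀ : En n → ℝ)
    (hu : ContDiffOn ℝ 2 u Ω) (hu' : ContinuousOn u (closure Ω))
    (hu₀ : ContDiffOn ℝ 2 u₀ Ω) (hu₀' : ContinuousOn u₀ (closure Ω))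
    (hconv : kConvexOn n k Ω u₀)
    (hF : ∀ x ∈ lowerContact n k Ω u, Fk n k u x < Fk n k u₀ x)
    (hbd : ∀ x ∈ frontier Ω, u₀ x ≤ u x) :
    ∀ x ∈ Ω, u₀ x ≤ u x := by

  intro y hy
  by_contra! hlt
  have hcont : ContinuousOn (fun z => u₀ z - u z) (closure Ω) := hu₀'.sub hu'
  obtain ⟨x, hxc, hmax⟩ :=
    hΩb.isCompact_closure.exists_isMaxOn ⟨y, subset_closure hy⟩ hcont
  have hmax' : ∀ z ∈ closure Ω, u₀ z - u z ≤ u₀ x - u x := fun z hz => hmax hz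
  have hpos : 0 < u₀ x - u x := by
    have := hmax' y (subset_closure hy)
    linarith
  have hx : x ∈ Ω := by
    by_contra hxΩ
    have := hbd x (by rw [hΩo.frontier_eq]; exact ⟨hxc, hxΩ⟩)
    linarith
  have hxn : Ω ∈ nhds x := hΩo.mem_nhds hx
  have hux : ContDiffAt ℝ 2 u x := hu.contDiffAt hxn
  have hu₀x : ContDiffAt ℝ 2 u₀ x := hu₀.contDiffAt hxn
  have hcontact : x ∈ lowerContact n k Ω u := by
    refine ⟨hx, fun z => u₀ z - (u₀ x - u x), hu₀.sub contDiffOn_const, fun z hz => ?_,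
      fun z hz => ?_, by ring⟩
    · rw [hess_sub_const]
      exact hconv z hz
    · have := hmax' z (subset_closure hz)
      linarith
  have hmin : IsLocalMin (fun z => u z - u₀ z) x := by
    filter_upwards [hxn] with z hz
    have := hmax' z (subset_closure hz)
    linarith
  have hpsd : (hess n u x - hess n u₀ x).PosSemidef := by
    rw [← hess_sub hux hu₀x]
    exact hess_posSemidef_of_isLocalMin (hux.sub hu₀x) hmin
  exact absurd (hF x hcontact)
    (not_lt.2 (esymm_eigs_le_of_posSemidef (hconv x hx).1 (hconv x hx).2 hpsd hk1))

end
end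

section
/- Let n ≥ 2, let k be an integer with 1 ≤ k ≤ n, and fix y ∈ ℝ^n. Define g : ℝ^n \ {y} → ℝ by g(x) = (1/(2 − n/k)) |x − y|^{2 − n/k} if 2k ≠ n, and g(x) = log|x − y| if 2k = n. Then for every x ≠ y, the Hessian D²g(x) satisfies λ(D²g(x)) ∈ Γ̄_k and S_k(λ(D²g(x))) = 0. -/
open MeasureTheory Metric Set Bornology
open scoped ENNReal

noncomputable section

/-- The `j`-th elementary symmetric function of one value `b` and `m` copies of `c`. -/
theorem esymm_succ_of_map_eq_cons_replicate {m : ℕ} {lam : Fin (m + 1) → ℝ} {b c : ℝ}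
    (h : (Finset.univ : Finset (Fin (m + 1))).val.map lam = b ::ₘ Multiset.replicate m c)
    {i : ℕ} (hi : i ≤ m) :
    esymm (m + 1) (i + 1) lam = c ^ (i + 1) * m.choose (i + 1) + b * (c ^ i * m.choose i) := by
  have key : ∏ t, (Polynomial.X + Polynomial.C (lam t)) =
      (Polynomial.X + Polynomial.C b) * (Polynomial.X + Polynomial.C c) ^ m := by
    have := congrArg (fun s => (s.map fun r => Polynomial.X + Polynomial.C r).prod) h
    rw [Multiset.map_map, Multiset.map_cons, Multiset.map_replicate, Multiset.prod_cons,
      Multiset.prod_replicate] at this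
    exact this
  have hc := Finset.prod_X_add_C_coeff (Finset.univ : Finset (Fin (m + 1))) lam
    (k := m - i) (by simp; omega)
  have hcard : (Finset.univ : Finset (Fin (m + 1))).card - (m - i) = i + 1 := by
    simp; omega
  rw [hcard, key] at hc
  rw [esymm, ← hc, add_mul, Polynomial.coeff_add, Polynomial.coeff_C_mul,
    Polynomial.coeff_X_add_C_pow, Nat.sub_sub_self hi, Nat.choose_symm hi]
  congr 1
  obtain hlt | rfl := hi.lt_or_eq
  · obtain ⟨d, rfl⟩ : ∃ d, m = d + (i + 1) := ⟨m - (i + 1), by omega⟩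
    rw [show d + (i + 1) - i = d + 1 by omega, Polynomial.coeff_X_mul,
      Polynomial.coeff_X_add_C_pow, Nat.add_sub_cancel_left, Nat.choose_symm_add]
  · simp

/-- The spectrum of a rank-one perturbation of a multiple of the identity. -/
theorem map_eigenvalues_of_eq_smul_one_add_vecMulVec {m : ℕ}
    {A : Matrix (Fin (m + 1)) (Fin (m + 1)) ℝ} (hA : A.IsHermitian) {c : ℝ}
    {u v : Fin (m + 1) → ℝ} (h : A = c • 1 + Matrix.vecMulVec u v) :
    (Finset.univ : Finset (Fin (m + 1))).val.map hA.eigenvalues =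
      (c + u ⬝ᵥ v) ::ₘ Multiset.replicate m c := by
  have hroots := hA.roots_charpoly_eq_eigenvalues
  have hsub : A = Matrix.vecMulVec u v - Matrix.scalar (Fin (m + 1)) (-c) := by
    rw [h, map_neg, sub_neg_eq_add, Matrix.scalar_apply, Matrix.smul_one_eq_diagonal]
    exact add_comm _ _
  have hchar : A.charpoly =
      (Polynomial.X - Polynomial.C (c + u ⬝ᵥ v)) * (Polynomial.X - Polynomial.C c) ^ m := by
    rw [hsub, Matrix.charpoly_sub_scalar, Matrix.charpoly_vecMulVec]
    simp [Polynomial.smul_eq_C_mul]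
    ring
  have hne : (Polynomial.X - Polynomial.C (c + u ⬝ᵥ v)) * (Polynomial.X - Polynomial.C c) ^ m ≠ 0 :=
    mul_ne_zero (Polynomial.X_sub_C_ne_zero _) (pow_ne_zero _ (Polynomial.X_sub_C_ne_zero _))
  rw [hchar, Polynomial.roots_mul hne, Polynomial.roots_pow, Polynomial.roots_X_sub_C,
    Polynomial.roots_X_sub_C, Multiset.nsmul_singleton, Multiset.singleton_add] at hroots
  simpa using hroots.symm

section Calculus

variable {E : Type*} [NormedAddCommGroup E] [InnerProductSpace ℝ E]

theorem hasFDerivAt_norm_sub_rpow (p : ℝ) {x y : E} (h : x ≠ y) :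
    HasFDerivAt (fun z => ‖z - y‖ ^ p) ((p * ‖x - y‖ ^ (p - 2)) • innerSL ℝ (x - y)) x := by
  have hpos : 0 < ‖x - y‖ := norm_pos_iff.2 (sub_ne_zero.2 h)
  have hsq : HasFDerivAt (fun z => ‖z - y‖ ^ 2) _ x := ((hasFDerivAt_id x).sub_const y).norm_sq
  have := hsq.rpow_const (p := p / 2) (Or.inl (by positivity))
  have hfun : (fun z => (‖z - y‖ ^ 2) ^ (p / 2)) = fun z => ‖z - y‖ ^ p := by
    funext z
    rw [← Real.rpow_natCast_mul (norm_nonneg _)]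
    congr 1
    push_cast
    ring
  rw [hfun] at this
  refine this.congr_fderiv ?_
  rw [← Real.rpow_natCast_mul hpos.le, show ((2 : ℕ) : ℝ) * (p / 2 - 1) = p - 2 by push_cast; ring]
  ext w
  simp
  ring

theorem hasFDerivAt_log_norm_sub {x y : E} (h : x ≠ y) :
    HasFDerivAt (fun z => Real.log ‖z - y‖) (‖x - y‖ ^ (-2 : ℝ) • innerSL ℝ (x - y)) x := by
  have hpos : 0 < ‖x - y‖ := norm_pos_iff.2 (sub_ne_zero.2 h)
  have := (hasFDerivAt_norm_sub_rpow 1 h)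
  simp only [Real.rpow_one, one_mul] at this
  refine (this.log hpos.ne').congr_fderiv ?_
  rw [smul_smul, ← Real.rpow_neg_one, ← Real.rpow_add hpos]
  norm_num

/-- The second derivative of a function whose gradient is `‖x - y‖ ^ p • (x - y)` off `y`. -/
theorem iteratedFDeriv_two_of_hasFDerivAt_norm_sub_rpow {f : E → ℝ} {y : E} {p : ℝ}
    (hf : ∀ x, x ≠ y → HasFDerivAt f (‖x - y‖ ^ p • innerSL ℝ (x - y)) x) {x : E} (h : x ≠ y)
    (v w : E) :
    iteratedFDeriv ℝ 2 f x ![v, w] = ‖x - y‖ ^ p * inner ℝ v w +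
      p * ‖x - y‖ ^ (p - 2) * inner ℝ (x - y) v * inner ℝ (x - y) w := by
  have heq : fderiv ℝ f =ᶠ[nhds x] fun z => ‖z - y‖ ^ p • innerSL ℝ (z - y) := by
    filter_upwards [isOpen_ne.mem_nhds h] with z hz using (hf z hz).fderiv
  have hinner : HasFDerivAt (fun z => innerSL ℝ (z - y)) (innerSL ℝ : E →L[ℝ] E →L[ℝ] ℝ) x :=
    (innerSL ℝ : E →L[ℝ] E →L[ℝ] ℝ).hasFDerivAt.comp x ((hasFDerivAt_id x).sub_const y)
  have hsecond : fderiv ℝ (fun z => ‖z - y‖ ^ p • innerSL ℝ (z - y)) x = _ :=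
    ((hasFDerivAt_norm_sub_rpow p h).smul hinner).fderiv
  rw [iteratedFDeriv_two_apply, heq.fderiv_eq, hsecond]
  simp [inner_sub_left, innerSL_apply_apply ℝ]

end Calculus

theorem hess_eq_of_hasFDerivAt_norm_sub_rpow {n : ℕ} {f : En n → ℝ} {y : En n} {p : ℝ}
    (hf : ∀ x, x ≠ y → HasFDerivAt f (‖x - y‖ ^ p • innerSL ℝ (x - y)) x) {x : En n} (h : x ≠ y) :
    hess n f x = ‖x - y‖ ^ p • 1 +
      Matrix.vecMulVec ((p * ‖x - y‖ ^ (p - 2)) • (x - y).ofLp) (x - y).ofLp := by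
  ext i j
  rw [hess, Matrix.of_apply, iteratedFDeriv_two_of_hasFDerivAt_norm_sub_rpow hf h]
  simp [Matrix.vecMulVec_apply, Matrix.one_apply, EuclideanSpace.inner_single_right, mul_assoc,
    eq_comm (a := i)]

/-- `S_{i+1}` of `m` copies of `c` and one of `(1 - (m + 1) / k) c`, in closed form. -/
theorem choose_succ_add_mul_choose {m k i : ℕ} (hi : i ≤ m) (hk : k ≠ 0) (c : ℝ) :
    c ^ (i + 1) * m.choose (i + 1) + (c - ((m + 1 : ℕ) : ℝ) / k * c) * (c ^ i * m.choose i) =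
      c ^ (i + 1) * m.choose i * (m + 1) * (1 / (i + 1) - 1 / k) := by
  have h : (m.choose (i + 1) : ℝ) * (i + 1) = m.choose i * (m - i) := by
    rw [← Nat.cast_sub hi]
    exact_mod_cast Nat.choose_succ_right_eq m i
  have hk' : (k : ℝ) ≠ 0 := Nat.cast_ne_zero.2 hk
  have hi' : (i : ℝ) + 1 ≠ 0 := by positivity
  rw [← eq_div_iff hi'] at h
  rw [h]
  push_cast
  field_simp
  ring

/-- The radial fundamental solution (3.4): its Hessian has eigenvalues in Γ̄_k
and satisfies S_k(λ(D²g)) = 0 away from the singularity. -/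
theorem fundamental_solution_kHessian (n k : ℕ) (hn : 2 ≤ n) (hk1 : 1 ≤ k) (hkn : k ≤ n)
    (y : En n) (g : En n → ℝ)
    (hg : ∀ x : En n, g x =
      if 2 * k = n then Real.log ‖x - y‖
      else (1 / (2 - (n : ℝ) / k)) * ‖x - y‖ ^ (2 - (n : ℝ) / k)) :
    ∀ x : En n, x ≠ y →
      (hess n g x).IsHermitian ∧ eigs n (hess n g x) ∈ GammaBar n k ∧
        esymm n k (eigs n (hess n g x)) = 0 := by
  intro x hx
  obtain ⟨m, rfl⟩ : ∃ m, n = m + 1 := ⟨n - 1, by omega⟩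
  have hk0 : (k : ℝ) ≠ 0 := by positivity
  set p : ℝ := -(((m + 1 : ℕ) : ℝ) / k) with hp
  have hgrad : ∀ z, z ≠ y → HasFDerivAt g (‖z - y‖ ^ p • innerSL ℝ (z - y)) z := by
    intro z hz
    rw [funext hg]
    split_ifs with h
    · have : p = -2 := by
        rw [hp, ← h]
        push_cast
        field_simp
      rw [this]
      exact hasFDerivAt_log_norm_sub hz
    · have hne : 2 - ((m + 1 : ℕ) : ℝ) / k ≠ 0 := by
        rw [sub_ne_zero, Ne, eq_div_iff hk0]
        exact_mod_cast h
      refine ((hasFDerivAt_norm_sub_rpow _ hz).const_mul _).congr_fderiv ?_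
      rw [smul_smul, ← mul_assoc, one_div_mul_cancel hne, one_mul, hp]
      congr 2
      ring
  have hess_eq := hess_eq_of_hasFDerivAt_norm_sub_rpow hgrad hx
  have hherm : (hess (m + 1) g x).IsHermitian := by
    rw [hess_eq]
    ext i j
    simp only [Matrix.conjTranspose_apply, Matrix.add_apply, Matrix.smul_apply, Matrix.one_apply,
      Matrix.vecMulVec_apply, Pi.smul_apply, smul_eq_mul, star_trivial, eq_comm (a := j)]
    ring
  have hpos : 0 < ‖x - y‖ := norm_pos_iff.2 (sub_ne_zero.2 hx)
  have hspec := map_eigenvalues_of_eq_smul_one_add_vecMulVec hherm hess_eq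
  have hdot : ((p * ‖x - y‖ ^ (p - 2)) • (x - y).ofLp) ⬝ᵥ (x - y).ofLp = p * ‖x - y‖ ^ p := by
    have : (x - y).ofLp ⬝ᵥ (x - y).ofLp = ‖x - y‖ ^ (2 : ℝ) := by
      rw [Real.rpow_two, EuclideanSpace.real_norm_sq_eq]
      simp [dotProduct, sq]
    rw [smul_dotProduct, this, smul_eq_mul, mul_assoc, ← Real.rpow_add hpos, sub_add_cancel]
  rw [hdot, show ∀ c : ℝ, c + p * c = c - ((m + 1 : ℕ) : ℝ) / k * c by intro c; rw [hp]; ring]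
    at hspec
  have hS : ∀ i, i ≤ m → esymm (m + 1) (i + 1) (eigs (m + 1) (hess (m + 1) g x)) =
      (‖x - y‖ ^ p) ^ (i + 1) * m.choose i * (m + 1) * (1 / (i + 1) - 1 / k) := by
    intro i hi
    rw [eigs, dif_pos hherm, esymm_succ_of_map_eq_cons_replicate hspec hi,
      choose_succ_add_mul_choose hi (by omega)]
  refine ⟨hherm, fun j hj1 hjk => ?_, ?_⟩
  · obtain ⟨i, rfl⟩ : ∃ i, j = i + 1 := ⟨j - 1, by omega⟩
    rw [hS i (by omega)]
    have : (1 : ℝ) / k ≤ 1 / (i + 1) :=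
      one_div_le_one_div_of_le (by positivity) (by exact_mod_cast hjk)
    exact mul_nonneg (by positivity) (sub_nonneg.2 this)
  · obtain ⟨i, rfl⟩ : ∃ i, k = i + 1 := ⟨k - 1, by omega⟩
    rw [hS i (by omega)]
    simp

end
end

section
/- Let n ≥ 2 and let k be an integer with 1 ≤ k ≤ n. If μ = (μ₁,…,μ_n) ∈ Γ_k, then for every index i ∈ {1,…,n} one has k(n−1)μ_i + (n−k) Σ_{j≠i} μ_j ≥ 0. -/
open MeasureTheory Metric Set Bornology
open scoped ENNReal

noncomputable section

open Polynomial in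
/-- Over `ℝ`, the derivative of a split polynomial splits. -/
theorem splits_derivative {p : ℝ[X]} (hp : p.Splits) : (derivative p).Splits := by
  rw [splits_iff_card_roots] at hp ⊢
  have h₁ := card_roots_le_derivative p
  have h₂ := card_roots' (derivative p)
  rw [natDegree_derivative] at h₂ ⊢
  lia

open Polynomial in
theorem coeff_laguerre_multiset (s : Multiset ℝ) :
    2 * (s.card : ℝ) * ((s.map fun a => X - C a).prod.coeff 0 *
        (s.map fun a => X - C a).prod.coeff 2) ≤
      (s.card - 1) * (s.map fun a => X - C a).prod.coeff 1 ^ 2 := by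
  induction s using Multiset.induction with
  | empty => simp [coeff_one]
  | cons a s ih =>
    rcases Multiset.empty_or_exists_mem s with rfl | ⟨b, hb⟩
    · simp [coeff_X, coeff_C]
    have hd : (1 : ℝ) ≤ s.card := by
      exact_mod_cast Multiset.card_pos_iff_exists_mem.2 ⟨b, hb⟩
    simp only [Multiset.map_cons, Multiset.prod_cons, Multiset.card_cons, Nat.cast_add,
      Nat.cast_one, sub_mul, coeff_sub, coeff_X_mul, coeff_C_mul, mul_coeff_zero, coeff_X_zero,
      coeff_C_zero, zero_mul]
    generalize (s.map fun a => X - C a).prod.coeff 0 = x at *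
    generalize (s.map fun a => X - C a).prod.coeff 1 = y at *
    generalize (s.map fun a => X - C a).prod.coeff 2 = z at *
    generalize (s.card : ℝ) = d at *
    have h₁ := mul_le_mul_of_nonneg_left ih (by positivity : 0 ≤ (d + 1) * a ^ 2)
    refine le_of_mul_le_mul_left ?_ (by positivity : 0 < d)
    nlinarith [sq_nonneg (d * x + a * y)]

open Polynomial in
theorem coeff_laguerre {p : ℝ[X]} (hp : p.Splits) :
    2 * (p.natDegree : ℝ) * (p.coeff 0 * p.coeff 2) ≤ (p.natDegree - 1) * p.coeff 1 ^ 2 := by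
  have h := mul_le_mul_of_nonneg_left (coeff_laguerre_multiset p.roots)
    (sq_nonneg p.leadingCoeff)
  rw [hp.natDegree_eq_card_roots]
  have hc (j : ℕ) : p.coeff j =
      p.leadingCoeff * (p.roots.map fun a => X - C a).prod.coeff j := by
    conv_lhs => rw [hp.eq_prod_roots, coeff_C_mul]
  rw [hc 0, hc 1, hc 2]
  linarith

open Polynomial in
/-- Newton's inequality for consecutive coefficients of a real-rooted polynomial. -/
theorem coeff_newton {p : ℝ[X]} (hp : p.Splits) (l : ℕ) (hl : l + 1 ≤ p.natDegree) :
    (l + 2) * (p.natDegree - l : ℝ) * (p.coeff l * p.coeff (l + 2)) ≤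
      (l + 1) * (p.natDegree - l - 1) * p.coeff (l + 1) ^ 2 := by
  induction l generalizing p with
  | zero => simpa using coeff_laguerre hp
  | succ l ih =>
    have h := ih (splits_derivative hp) (by rw [natDegree_derivative]; lia)
    rw [natDegree_derivative, Nat.cast_sub (by lia)] at h
    simp only [coeff_derivative] at h
    push_cast at h ⊢
    refine le_of_mul_le_mul_left ?_ (by positivity : 0 < ((l : ℝ) + 1) * (l + 2))
    linarith

open Polynomial in
/-- Newton's inequality for elementary symmetric functions. -/
theorem esymm_newton (s : Multiset ℝ) (j : ℕ) (hj : j + 2 ≤ s.card) :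
    (j + 2) * (s.card - j : ℝ) * (s.esymm (j + 2) * s.esymm j) ≤
      (j + 1) * (s.card - j - 1) * s.esymm (j + 1) ^ 2 := by
  obtain ⟨l, hl⟩ := Nat.exists_eq_add_of_le hj
  have hs : (s.map fun a => X + C a).prod.Splits :=
    Splits.multisetProd fun f hf => by
      obtain ⟨a, -, rfl⟩ := Multiset.mem_map.1 hf
      exact Splits.X_add_C a
  have hd : (s.map fun a => X + C a).prod.natDegree = s.card := by
    rw [natDegree_multiset_prod_of_monic]
    · simp
    · intro f hf
      obtain ⟨a, -, rfl⟩ := Multiset.mem_map.1 hf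
      exact monic_X_add_C a
  have h := coeff_newton hs l (by lia)
  rw [hd, s.prod_X_add_C_coeff (by lia), s.prod_X_add_C_coeff (by lia),
    s.prod_X_add_C_coeff (by lia), show s.card - l = j + 2 by lia,
    show s.card - (l + 2) = j by lia, show s.card - (l + 1) = j + 1 by lia] at h
  rw [hl] at h ⊢
  push_cast at h ⊢
  linarith

/-- A Maclaurin-type inequality, valid as long as the elementary symmetric functions involved
are positive. -/
theorem esymm_maclaurin (s : Multiset ℝ) (j : ℕ) (hj : j + 1 ≤ s.card)
    (hpos : ∀ l ≤ j, 0 < s.esymm l) :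
    (j + 1) * (s.card : ℝ) * s.esymm (j + 1) ≤ (s.card - j) * (s.sum * s.esymm j) := by
  induction j with
  | zero => simp [Multiset.esymm, Multiset.powersetCard_one]
  | succ j ih =>
    have h₁ := ih (by lia) fun l hl => hpos l (by lia)
    have h₂ := esymm_newton s j (by lia)
    have h₃ : (j : ℝ) + 2 ≤ s.card := by exact_mod_cast hj
    have hj₀ := hpos j (by lia)
    have hj₁ := hpos (j + 1) le_rfl
    push_cast
    rw [show j + 1 + 1 = j + 2 from rfl]
    generalize s.esymm (j + 2) = x at *
    generalize s.esymm (j + 1) = y at *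
    generalize s.esymm j = z at *
    generalize (s.card : ℝ) = m at *
    have hj' : (0 : ℝ) ≤ j := j.cast_nonneg
    refine le_of_mul_le_mul_left ?_ (mul_pos (by linarith : 0 < m - j) hj₀)
    have h₄ := mul_le_mul_of_nonneg_left h₂ (by linarith : 0 ≤ m)
    have h₅ := mul_le_mul_of_nonneg_left h₁
      (mul_nonneg (by linarith : 0 ≤ m - j - 1) hj₁.le)
    linarith

theorem esymm_cons_succ (a : ℝ) (s : Multiset ℝ) (j : ℕ) :
    (a ::ₘ s).esymm (j + 1) = s.esymm (j + 1) + a * s.esymm j := by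
  simp [Multiset.esymm, Multiset.powersetCard_cons, Multiset.sum_map_mul_left]

/-- If the first `k` elementary symmetric functions of `a, s` are positive, then `a` is bounded
below in terms of the sum of the remaining entries `s`. -/
theorem cons_lower_bound (a : ℝ) (s : Multiset ℝ) (k : ℕ) (hk : k ≤ s.card)
    (hpos : ∀ j ≤ k, 0 < (a ::ₘ s).esymm (j + 1)) :
    0 ≤ (k + 1) * (s.card : ℝ) * a + (s.card - k) * s.sum := by
  have hk' : (k : ℝ) ≤ s.card := by exact_mod_cast hk
  have hs : 0 < s.sum + a := by
    simpa [esymm_cons_succ, Multiset.esymm, Multiset.powersetCard_one] using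
      hpos 0 (Nat.zero_le k)
  rcases le_or_gt 0 a with ha | ha
  · have h₁ := mul_nonneg (sub_nonneg.2 hk') hs.le
    have h₂ : 0 ≤ (k : ℝ) * (s.card + 1) * a := by positivity
    linarith
  have hσ : ∀ j ≤ k + 1, 0 < s.esymm j := by
    intro j
    induction j with
    | zero => simp [Multiset.esymm]
    | succ j ih =>
      intro hj
      have h := hpos j (by lia)
      rw [esymm_cons_succ] at h
      nlinarith [mul_neg_of_neg_of_pos ha (ih (by lia))]
  have hk₁ : k + 1 ≤ s.card := by
    by_contra! h
    have := hσ (k + 1) le_rfl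
    simp [Multiset.esymm, Multiset.powersetCard_eq_empty _ h] at this
  have h₁ := esymm_maclaurin s k hk₁ fun l hl => hσ l (by lia)
  have h₂ := hpos k le_rfl
  rw [esymm_cons_succ] at h₂
  refine le_of_mul_le_mul_right ?_ (hσ k (by lia))
  have h₃ := mul_nonneg (by positivity : 0 ≤ ((k : ℝ) + 1) * s.card) h₂.le
  linarith

/-- Inequality (1.15): for μ ∈ Γ_k, k(n-1)μ_i + (n-k)∑_{j≠i} μ_j ≥ 0. -/
theorem gammaK_eigenvalue_lower_bound (n k : ℕ) (hn : 2 ≤ n) (hk1 : 1 ≤ k) (hkn : k ≤ n)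
    (mu : Fin n → ℝ) (hmu : mu ∈ Gamma n k) (i : Fin n) :
    0 ≤ (k : ℝ) * ((n : ℝ) - 1) * mu i +
      ((n : ℝ) - (k : ℝ)) * ∑ j ∈ Finset.univ.erase i, mu j := by
  obtain ⟨k, rfl⟩ := Nat.exists_eq_add_of_le' hk1
  have hcons : Finset.univ.val.map mu = mu i ::ₘ (Finset.univ.erase i).val.map mu := by
    rw [← Multiset.map_cons, Finset.erase_val, Multiset.cons_erase (Finset.mem_univ_val i)]
  have hcard : ((Finset.univ.erase i).val.map mu).card = n - 1 := by simp
  have h := cons_lower_bound (mu i) ((Finset.univ.erase i).val.map mu) k (by lia) fun j hj => by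
    rw [← hcons, Finset.esymm_map_val]
    exact hmu (j + 1) (by lia) (by lia)
  rw [hcard, Nat.cast_sub (by lia)] at h
  change 0 ≤ _ + _ * ((Finset.univ.erase i).val.map mu).sum
  push_cast at h ⊢
  linarith

end
end

section
/- Let n ≥ 2 and α < 1, and for x ∈ ℝ^n \ {0} define the symmetric matrix A(x) = I + (−1 + (n−1)/(1−α)) (x xᵀ)/|x|². Define u : ℝ^n \ {0} → ℝ by u(x) = |x|^α if α ≠ 0 and u(x) = log|x| if α = 0. Then tr(A(x) D²u(x)) = 0 for every x ≠ 0; equivalently, Δu + (−1 + (n−1)/(1−α)) (x_i x_j/|x|²) D_{ij}u = 0 on ℝ^n \ {0}. -/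
open MeasureTheory Metric Set Bornology
open scoped ENNReal

noncomputable section

section Radial

variable {E : Type*} [NormedAddCommGroup E] [InnerProductSpace ℝ E]

lemma hasFDerivAt_norm_rpow_of_ne_zero (β : ℝ) {x : E} (hx : x ≠ 0) :
    HasFDerivAt (fun y : E => ‖y‖ ^ β) ((β * ‖x‖ ^ (β - 2)) • innerSL ℝ x) x := by
  have hpos : 0 < ‖x‖ := norm_pos_iff.2 hx
  have h := (hasStrictFDerivAt_norm_sq x).hasFDerivAt.rpow_const (p := β / 2)
    (Or.inl (pow_pos hpos 2).ne')
  have hpow : ∀ (y : E) (γ : ℝ), (‖y‖ ^ 2) ^ (γ / 2) = ‖y‖ ^ γ := fun y γ => by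
    rw [← Real.rpow_natCast_mul (norm_nonneg y)]
    congr 1
    push_cast
    ring
  simp only [hpow, show β / 2 - 1 = (β - 2) / 2 by ring] at h
  refine h.congr_fderiv ?_
  ext v
  simp
  ring

lemma hasFDerivAt_log_norm {x : E} (hx : x ≠ 0) :
    HasFDerivAt (fun y : E => Real.log ‖y‖) (‖x‖ ^ (-2 : ℝ) • innerSL ℝ x) x := by
  have hpos : 0 < ‖x‖ := norm_pos_iff.2 hx
  have h := ((hasFDerivAt_norm_rpow_of_ne_zero 1 hx).log (by simpa using hx))
  simp only [Real.rpow_one] at h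
  refine h.congr_fderiv ?_
  rw [smul_smul, one_mul, ← Real.rpow_neg_one, ← Real.rpow_add hpos]
  norm_num

lemma fderiv_fderiv_apply_of_radial {u : E → ℝ} {c β : ℝ}
    (hu : ∀ y : E, y ≠ 0 → HasFDerivAt u ((c * ‖y‖ ^ β) • innerSL ℝ y) y)
    {x : E} (hx : x ≠ 0) (v w : E) :
    fderiv ℝ (fderiv ℝ u) x v w =
      c * ‖x‖ ^ β * (inner ℝ v w + β / ‖x‖ ^ 2 * (inner ℝ x v * inner ℝ x w)) := by
  have hpos : 0 < ‖x‖ := norm_pos_iff.2 hx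
  have hev : fderiv ℝ u =ᶠ[nhds x] fun y => (c * ‖y‖ ^ β) • innerSL ℝ y := by
    filter_upwards [isOpen_ne.mem_nhds hx] with y hy using (hu y hy).fderiv
  have hinner : HasFDerivAt (fun y : E => innerSL ℝ y) (innerSL ℝ : E →L[ℝ] E →L[ℝ] ℝ) x :=
    (innerSL ℝ : E →L[ℝ] E →L[ℝ] ℝ).hasFDerivAt
  have h := ((hasFDerivAt_norm_rpow_of_ne_zero β hx).const_mul c).smul hinner
  rw [hev.fderiv_eq, HasFDerivAt.fderiv (f := fun y : E => (c * ‖y‖ ^ β) • innerSL ℝ y) h]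
  have hsub : ‖x‖ ^ (β - 2) = ‖x‖ ^ β / ‖x‖ ^ 2 := by
    rw [Real.rpow_sub hpos, Real.rpow_two]
  have happly : (innerSL ℝ : E →L[ℝ] E →L[ℝ] ℝ) v w = inner ℝ v w := rfl
  simp [hsub, happly]
  ring

end Radial

lemma hess_of_radial {n : ℕ} {u : En n → ℝ} {c β : ℝ}
    (hu : ∀ y : En n, y ≠ 0 → HasFDerivAt u ((c * ‖y‖ ^ β) • innerSL ℝ y) y)
    {x : En n} (hx : x ≠ 0) :
    hess n u x = (c * ‖x‖ ^ β) •
      (1 + (β / ‖x‖ ^ 2) • Matrix.of (fun i j => x i * x j)) := by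
  ext i j
  simp only [hess, Matrix.of_apply, iteratedFDeriv_two_apply, Matrix.cons_val_zero,
    Matrix.cons_val_one, fderiv_fderiv_apply_of_radial hu hx]
  simp [EuclideanSpace.inner_single_right, Matrix.one_apply, eq_comm]

lemma trace_one_add_smul_mul_one_add_smul {n : ℕ} (a b : ℝ) {x : En n} (hx : x ≠ 0) :
    ((1 + (a / ‖x‖ ^ 2) • Matrix.of (fun i j => x i * x j)) *
      (1 + (b / ‖x‖ ^ 2) • Matrix.of (fun i j => x i * x j)) :
        Matrix (Fin n) (Fin n) ℝ).trace = n + a + b + a * b := by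
  have hr : ‖x‖ ^ 2 ≠ 0 := pow_ne_zero 2 (norm_ne_zero_iff.2 hx)
  have hP : (Matrix.of fun i j => x i * x j) = Matrix.vecMulVec x x := rfl
  have hdot : (x : Fin n → ℝ) ⬝ᵥ x = ‖x‖ ^ 2 := by
    simp [EuclideanSpace.real_norm_sq_eq, dotProduct, ← sq]
  rw [hP]
  simp only [add_mul, mul_add, one_mul, mul_one, smul_mul_assoc, mul_smul_comm,
    Matrix.vecMulVec_mul_vecMulVec, Matrix.trace_add, Matrix.trace_smul, Matrix.trace_one,
    Matrix.trace_vecMulVec, hdot, Fintype.card_fin, smul_eq_mul, Matrix.vecMulVec_smul]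
  field_simp
  ring

/-- The Gilbarg–Serrin example (1.14)-(1.15): u(x) = |x|^α (resp. log|x| for α = 0)
solves tr(A(x) D²u(x)) = 0 away from the origin. -/
theorem gilbarg_serrin_solution (n : ℕ) (hn : 2 ≤ n) (α : ℝ) (hα : α < 1)
    (A : En n → Matrix (Fin n) (Fin n) ℝ)
    (hA : ∀ x : En n, A x =
      1 + ((-1 + ((n : ℝ) - 1) / (1 - α)) / ‖x‖ ^ 2) • Matrix.of (fun i j => x i * x j))
    (u : En n → ℝ)
    (hu : ∀ x : En n, u x = if α = 0 then Real.log ‖x‖ else ‖x‖ ^ α) :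
    ∀ x : En n, x ≠ 0 → (A x * hess n u x).trace = 0 := by
  intro x hx
  have hgrad : ∃ c : ℝ, ∀ y : En n, y ≠ 0 →
      HasFDerivAt u ((c * ‖y‖ ^ (α - 2)) • innerSL ℝ y) y := by
    rw [funext hu]
    by_cases h0 : α = 0
    · refine ⟨1, fun y hy => ?_⟩
      simpa [h0] using hasFDerivAt_log_norm hy
    · refine ⟨α, fun y hy => ?_⟩
      simpa [h0] using hasFDerivAt_norm_rpow_of_ne_zero α hy
  obtain ⟨c, hc⟩ := hgrad
  have hα' : 1 - α ≠ 0 := by linarith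
  rw [hA, hess_of_radial hc hx, mul_smul_comm, Matrix.trace_smul,
    trace_one_add_smul_mul_one_add_smul _ _ hx, smul_eq_mul]
  convert mul_zero _ using 2
  field_simp
  ring

end
end

section
/- Let n ≥ 2. Then Γ*_2 = {λ ∈ ℝ^n : |λ| ≤ (1/√(n−1)) Σ_{i=1}^n λ_i}, where |λ| is the Euclidean norm. -/
open MeasureTheory Metric Set Bornology
open scoped ENNReal

noncomputable section

/-- `2 S_2(f) + Σ f i ^ 2 = (Σ f i) ^ 2` over an arbitrary finite set. -/
theorem two_mul_sum_powersetCard_two_add_sum_sq {ι R : Type*} [DecidableEq ι] [CommRing R]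
    (s : Finset ι) (f : ι → R) :
    2 * ∑ t ∈ s.powersetCard 2, ∏ i ∈ t, f i + ∑ i ∈ s, f i ^ 2 = (∑ i ∈ s, f i) ^ 2 := by
  induction s using Finset.induction_on with
  | empty => simp [show (∅ : Finset ι).powersetCard 2 = ∅ from rfl]
  | insert a s ha ih =>
    have hdisj : Disjoint (s.powersetCard 2) ((s.powersetCard 1).image (insert a)) := by
      rw [Finset.disjoint_left]
      intro t ht ht'
      obtain ⟨u, -, rfl⟩ := Finset.mem_image.1 ht'
      exact ha ((Finset.mem_powersetCard.1 ht).1 (Finset.mem_insert_self a u))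
    have hinj : Set.InjOn (insert a) (s.powersetCard 1 : Set (Finset ι)) := by
      intro u hu v hv huv
      have hau : a ∉ u := fun h => ha ((Finset.mem_powersetCard.1 hu).1 h)
      have hav : a ∉ v := fun h => ha ((Finset.mem_powersetCard.1 hv).1 h)
      rw [← Finset.erase_insert hau, ← Finset.erase_insert hav]
      exact congrArg (fun w => Finset.erase w a) huv
    have himage : ∑ t ∈ (s.powersetCard 1).image (insert a), ∏ i ∈ t, f i
        = f a * ∑ i ∈ s, f i := by
      rw [Finset.sum_image hinj, Finset.powersetCard_one, Finset.sum_map, Finset.mul_sum]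
      refine Finset.sum_congr rfl fun i hi => ?_
      have hai : a ≠ i := fun h => ha (h ▸ hi)
      exact Finset.prod_pair hai
    rw [Finset.powersetCard_succ_insert ha, Finset.sum_union hdisj, himage,
      Finset.sum_insert ha, Finset.sum_insert ha]
    linear_combination ih

theorem esymm_one (n : ℕ) (mu : Fin n → ℝ) : esymm n 1 mu = ∑ i, mu i := by
  simp [esymm, Finset.powersetCard_one]

theorem mem_Gamma_two_iff (n : ℕ) (mu : Fin n → ℝ) :
    mu ∈ Gamma n 2 ↔ 0 < ∑ i, mu i ∧ ∑ i, mu i ^ 2 < (∑ i, mu i) ^ 2 := by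
  have h : 2 * esymm n 2 mu + ∑ i, mu i ^ 2 = (∑ i, mu i) ^ 2 :=
    two_mul_sum_powersetCard_two_add_sum_sq Finset.univ mu
  constructor
  · intro hmu
    have h1 := hmu 1 le_rfl one_le_two
    have h2 := hmu 2 one_le_two le_rfl
    rw [esymm_one] at h1
    exact ⟨h1, by linarith⟩
  · rintro ⟨h1, h2⟩ j hj1 hj2
    interval_cases j
    · rwa [esymm_one]
    · linarith

/-- Cauchy–Schwarz for the components orthogonal to the diagonal. -/
theorem card_mul_sum_mul_sub_sq_le {n : ℕ} (hn : 0 < n) (x y : Fin n → ℝ) :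
    (n * ∑ i, x i * y i - (∑ i, x i) * ∑ i, y i) ^ 2 ≤
      (n * ∑ i, x i ^ 2 - (∑ i, x i) ^ 2) * (n * ∑ i, y i ^ 2 - (∑ i, y i) ^ 2) := by
  have hn' : (0 : ℝ) < n := Nat.cast_pos.2 hn
  have key (u v : Fin n → ℝ) :
      ∑ i, (n * u i - ∑ j, u j) * (n * v i - ∑ j, v j) =
        n * (n * ∑ i, u i * v i - (∑ i, u i) * ∑ i, v i) := by
    calc
      _ = ∑ i, ((n : ℝ) ^ 2 * (u i * v i) - (n * ∑ j, v j) * u i - (n * ∑ j, u j) * v i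
            + (∑ j, u j) * ∑ j, v j) := Finset.sum_congr rfl fun i _ => by ring
      _ = _ := by
        simp only [Finset.sum_add_distrib, Finset.sum_sub_distrib, ← Finset.mul_sum,
          Finset.sum_const, Finset.card_univ, Fintype.card_fin, nsmul_eq_mul]
        ring
  have hcs := Finset.sum_mul_sq_le_sq_mul_sq Finset.univ
    (fun i => n * x i - ∑ j, x j) (fun i => n * y i - ∑ j, y j)
  simp only [sq (_ - _)] at hcs
  simp only [key] at hcs
  refine le_of_mul_le_mul_left ?_ (pow_pos hn' 2)
  simp only [sq] at hcs ⊢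
  linarith

/-- The dual cone condition without square roots. -/
theorem mem_GammaStar_two_iff (n : ℕ) (hn : 2 ≤ n) (lam : Fin n → ℝ) :
    lam ∈ GammaStar n 2 ↔
      0 ≤ ∑ i, lam i ∧ ((n : ℝ) - 1) * ∑ i, lam i ^ 2 ≤ (∑ i, lam i) ^ 2 := by
  have hn2 : (2 : ℝ) ≤ n := by exact_mod_cast hn
  have hn0 : (0 : ℝ) < n := by linarith
  have hn1 : (0 : ℝ) < n - 1 := by linarith
  set t := ∑ i, lam i with ht
  set p := ∑ i, lam i ^ 2 with hp
  constructor
  · intro h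
    have ht0 : 0 ≤ t := by
      have h1 : (fun _ => 1 : Fin n → ℝ) ∈ Gamma n 2 := by
        rw [mem_Gamma_two_iff]
        simp only [one_pow, Finset.sum_const, Finset.card_univ, Fintype.card_fin, nsmul_eq_mul,
          mul_one]
        exact ⟨hn0, by nlinarith⟩
      simpa using h _ h1
    refine ⟨ht0, ?_⟩
    -- `r2` is the squared norm of the component of `lam` orthogonal to the diagonal.
    set r2 := p - t ^ 2 / n with hr2
    have hr2n : n * r2 = n * p - t ^ 2 := by rw [hr2]; field_simp
    have hr0 : 0 ≤ r2 := by
      have := sq_sum_le_card_mul_sum_sq (s := Finset.univ) (f := lam)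
      rw [Finset.card_univ, Fintype.card_fin, ← ht, ← hp] at this
      nlinarith
    have hnn : 0 < (n : ℝ) * (n - 1) := mul_pos hn0 hn1
    have test (a : ℝ) (ha : 0 < a) (har : r2 < n * (n - 1) * a ^ 2) : r2 ≤ a * t := by
      have hs : ∑ i, (a + t / n - lam i) = n * a := by
        simp only [Finset.sum_sub_distrib, Finset.sum_const, Finset.card_univ, Fintype.card_fin,
          nsmul_eq_mul, ← ht]
        field_simp
        ring
      have hq : ∑ i, (a + t / n - lam i) ^ 2 = n * a ^ 2 + r2 := by
        simp only [sub_sq, Finset.sum_add_distrib, Finset.sum_sub_distrib, ← Finset.mul_sum,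
          Finset.sum_const, Finset.card_univ, Fintype.card_fin, nsmul_eq_mul, ← ht, ← hp, hr2]
        field_simp
        ring
      have hm : (fun i => a + t / n - lam i) ∈ Gamma n 2 := by
        rw [mem_Gamma_two_iff, hs, hq]
        exact ⟨mul_pos hn0 ha, by nlinarith⟩
      have hdot : ∑ i, lam i * (a + t / n - lam i) = a * t - r2 := by
        simp only [mul_sub, ← sq, Finset.sum_sub_distrib, ← Finset.sum_mul, ← ht, ← hp, hr2]
        field_simp
        ring
      have := h _ hm
      rw [hdot] at this
      linarith
    set a₀ := Real.sqrt (r2 / (n * (n - 1))) with ha₀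
    have ha₀0 : 0 ≤ a₀ := Real.sqrt_nonneg _
    have ha₀sq : n * (n - 1) * a₀ ^ 2 = r2 := by
      rw [ha₀, Real.sq_sqrt (div_nonneg hr0 hnn.le)]
      field_simp
    have hlim : r2 ≤ a₀ * t := by
      by_contra! hlt
      set e := (r2 - a₀ * t) / (t + 1) with he
      have he0 : 0 < e := div_pos (by linarith) (by linarith)
      have hee : e * (t + 1) = r2 - a₀ * t := div_mul_cancel₀ _ (by linarith)
      have hsq : a₀ ^ 2 < (a₀ + e) ^ 2 := by nlinarith
      have := test (a₀ + e) (by linarith) (by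
        rw [← ha₀sq]; exact mul_lt_mul_of_pos_left hsq hnn)
      nlinarith
    have hle : n * (n - 1) * a₀ ≤ t := by
      rcases ha₀0.eq_or_lt with h0 | h0
      · rw [← h0]; linarith
      · refine le_of_mul_le_mul_left ?_ h0
        linarith
    have hfin : n * (n - 1) * r2 ≤ t ^ 2 := by
      have := pow_le_pow_left₀ (mul_nonneg hnn.le ha₀0) hle 2
      rw [← ha₀sq]
      linarith
    nlinarith
  · rintro ⟨ht0, hpt⟩ mu hmu
    obtain ⟨hs, hq⟩ := (mem_Gamma_two_iff n mu).1 hmu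
    have hcs := card_mul_sum_mul_sub_sq_le (by omega : 0 < n) lam mu
    rw [← ht, ← hp] at hcs
    set s := ∑ i, mu i
    set q := ∑ i, mu i ^ 2
    set d := ∑ i, lam i * mu i
    have h1 : (n - 1) * (n * p - t ^ 2) ≤ t ^ 2 := by nlinarith
    have h2 : n * q - s ^ 2 ≤ (n - 1) * s ^ 2 := by nlinarith
    have h3 : 0 ≤ n * p - t ^ 2 := by
      have := sq_sum_le_card_mul_sum_sq (s := Finset.univ) (f := lam)
      rw [Finset.card_univ, Fintype.card_fin, ← ht, ← hp] at this
      linarith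
    have h4 : (n * d - t * s) ^ 2 ≤ (t * s) ^ 2 := by
      calc
        _ ≤ (n * p - t ^ 2) * (n * q - s ^ 2) := hcs
        _ ≤ (n * p - t ^ 2) * ((n - 1) * s ^ 2) := mul_le_mul_of_nonneg_left h2 h3
        _ = (n - 1) * (n * p - t ^ 2) * s ^ 2 := by ring
        _ ≤ t ^ 2 * s ^ 2 := mul_le_mul_of_nonneg_right h1 (sq_nonneg s)
        _ = _ := by ring
    have h5 := (abs_le.1 (abs_le_of_sq_le_sq h4 (mul_nonneg ht0 hs.le))).1
    exact nonneg_of_mul_nonneg_right (by linarith : 0 ≤ (n : ℝ) * d) hn0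

/-- Characterization (1.13) of the dual cone Γ*_2. -/
theorem gammaStar_two_eq (n : ℕ) (hn : 2 ≤ n) :
    GammaStar n 2 = {lam : Fin n → ℝ |
      Real.sqrt (∑ i, (lam i) ^ 2) ≤ (1 / Real.sqrt ((n : ℝ) - 1)) * ∑ i, lam i} := by
  have hn2 : (2 : ℝ) ≤ n := by exact_mod_cast hn
  have hn1 : (0 : ℝ) < n - 1 := by linarith
  have hsqrt : 0 < Real.sqrt ((n : ℝ) - 1) := Real.sqrt_pos.2 hn1
  ext lam
  rw [mem_GammaStar_two_iff n hn, Set.mem_ofPred_eq, one_div_mul_eq_div, le_div_iff₀ hsqrt,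
    ← Real.sqrt_mul (Finset.sum_nonneg fun i _ => sq_nonneg (lam i)), mul_comm, Real.sqrt_le_iff]

end
end

section
/- Let n ≥ 2. For every λ ∈ Γ*_2, one has ρ*_2(λ) = (1/√n) [ (Σ_{i=1}^n λ_i)² − (n−1)|λ|² ]^{1/2}, where |λ| is the Euclidean norm. -/
open MeasureTheory Metric Set Bornology
open scoped ENNReal

noncomputable section

theorem sum_powersetCard_two_prod {ι R : Type*} [DecidableEq ι] [CommRing R] (s : Finset ι)
    (f : ι → R) :
    2 * ∑ t ∈ Finset.powersetCard 2 s, ∏ i ∈ t, f i = (∑ i ∈ s, f i) ^ 2 - ∑ i ∈ s, f i ^ 2 := by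
  induction s using Finset.induction_on with
  | empty =>
    have h : Finset.powersetCard 2 (∅ : Finset ι) = ∅ := Finset.powersetCard_eq_empty.2 (by simp)
    simp [h]
  | insert a s ha ih =>
    have hdisj : Disjoint (Finset.powersetCard 2 s)
        ((Finset.powersetCard 1 s).image (insert a)) := by
      rw [Finset.disjoint_left]
      intro t ht ht'
      obtain ⟨u, -, rfl⟩ := Finset.mem_image.1 ht'
      exact ha ((Finset.mem_powersetCard.1 ht).1 (Finset.mem_insert_self a u))
    have hinj : Set.InjOn (insert a) (Finset.powersetCard 1 s : Set (Finset ι)) := by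
      intro u hu v hv huv
      have hau : a ∉ u := fun h' => ha ((Finset.mem_powersetCard.1 hu).1 h')
      have hav : a ∉ v := fun h' => ha ((Finset.mem_powersetCard.1 hv).1 h')
      rw [← Finset.erase_insert hau, huv, Finset.erase_insert hav]
    have hins : ∑ u ∈ Finset.powersetCard 1 s, ∏ i ∈ insert a u, f i = f a * ∑ i ∈ s, f i := by
      rw [Finset.powersetCard_one, Finset.sum_map, Finset.mul_sum]
      refine Finset.sum_congr rfl fun i hi => ?_
      have hai : a ≠ i := fun h' => ha (h' ▸ hi)
      simp [hai]
    rw [Finset.powersetCard_succ_insert ha, Finset.sum_union hdisj, Finset.sum_image hinj, hins,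
      Finset.sum_insert ha, Finset.sum_insert ha, mul_add, ih]
    ring

theorem two_mul_esymm_two (n : ℕ) (mu : Fin n → ℝ) :
    2 * esymm n 2 mu = (∑ i, mu i) ^ 2 - ∑ i, mu i ^ 2 :=
  sum_powersetCard_two_prod _ _

theorem mem_Gamma_two {n : ℕ} {mu : Fin n → ℝ} :
    mu ∈ Gamma n 2 ↔ 0 < ∑ i, mu i ∧ ∑ i, mu i ^ 2 < (∑ i, mu i) ^ 2 := by
  have h2 := two_mul_esymm_two n mu
  constructor
  · intro h
    refine ⟨esymm_one n mu ▸ h 1 le_rfl one_le_two, ?_⟩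
    linarith [h 2 one_le_two le_rfl]
  · rintro ⟨h1, h3⟩ j hj hj'
    interval_cases j
    · rwa [esymm_one]
    · linarith

theorem one_le_rho_two {n : ℕ} (hn : 2 ≤ n) {mu : Fin n → ℝ} :
    1 ≤ rho n 2 mu ↔ (n : ℝ) * (n - 1) ≤ (∑ i, mu i) ^ 2 - ∑ i, mu i ^ 2 := by
  have hn' : (2 : ℝ) ≤ n := by exact_mod_cast hn
  have hpos : (0 : ℝ) < n * (n - 1) / 2 := by nlinarith
  rw [← two_mul_esymm_two, rho, Nat.cast_ofNat, ← Real.sqrt_eq_rpow, Real.one_le_sqrt,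
    Nat.cast_choose_two, one_le_div hpos, div_le_iff₀ two_pos, mul_comm (esymm n 2 mu)]

/-- The sum of squared deviations of `lam` from its mean. -/
def sqDev (n : ℕ) (lam : Fin n → ℝ) : ℝ :=
  ∑ i, (lam i - (∑ j, lam j) / n) ^ 2

theorem sqDev_nonneg (n : ℕ) (lam : Fin n → ℝ) : 0 ≤ sqDev n lam :=
  Finset.sum_nonneg fun _ _ => sq_nonneg _

theorem sum_sub_mul_sub_mean {n : ℕ} (hn : n ≠ 0) (lam mu : Fin n → ℝ) :
    ∑ i, (lam i - (∑ j, lam j) / n) * (mu i - (∑ j, mu j) / n) =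
      ∑ i, lam i * mu i - (∑ i, lam i) * (∑ i, mu i) / n := by
  have hn' : (n : ℝ) ≠ 0 := by exact_mod_cast hn
  simp only [sub_mul, mul_sub, Finset.sum_sub_distrib, ← Finset.sum_mul, ← Finset.mul_sum,
    Finset.sum_const, Finset.card_univ, Fintype.card_fin, nsmul_eq_mul]
  field_simp
  ring

theorem sqDev_eq {n : ℕ} (hn : n ≠ 0) (lam : Fin n → ℝ) :
    sqDev n lam = ∑ i, lam i ^ 2 - (∑ i, lam i) ^ 2 / n := by
  simpa only [sqDev, sq] using sum_sub_mul_sub_mean hn lam lam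

theorem sq_sum_mul_sub_le {n : ℕ} (hn : n ≠ 0) (lam mu : Fin n → ℝ) :
    (∑ i, lam i * mu i - (∑ i, lam i) * (∑ i, mu i) / n) ^ 2 ≤ sqDev n lam * sqDev n mu := by
  rw [← sum_sub_mul_sub_mean hn]
  exact Finset.sum_mul_sq_le_sq_mul_sq _ _ _

/-- A vector with mean `b` whose deviation from the mean is `k` times that of `lam`. -/
def meanShift (n : ℕ) (lam : Fin n → ℝ) (b k : ℝ) (i : Fin n) : ℝ :=
  b + k * (lam i - (∑ j, lam j) / n)

theorem sum_sub_mean {n : ℕ} (hn : n ≠ 0) (lam : Fin n → ℝ) :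
    ∑ i, (lam i - (∑ j, lam j) / n) = 0 := by
  have hn' : (n : ℝ) ≠ 0 := by exact_mod_cast hn
  simp only [Finset.sum_sub_distrib, Finset.sum_const, Finset.card_univ, Fintype.card_fin,
    nsmul_eq_mul]
  field_simp
  ring

theorem sum_meanShift {n : ℕ} (hn : n ≠ 0) (lam : Fin n → ℝ) (b k : ℝ) :
    ∑ i, meanShift n lam b k i = n * b := by
  simp only [meanShift, Finset.sum_add_distrib, ← Finset.mul_sum, sum_sub_mean hn]
  simp

theorem sum_meanShift_sq {n : ℕ} (hn : n ≠ 0) (lam : Fin n → ℝ) (b k : ℝ) :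
    ∑ i, meanShift n lam b k i ^ 2 = n * b ^ 2 + k ^ 2 * sqDev n lam := by
  have h (i : Fin n) : meanShift n lam b k i ^ 2 =
      b ^ 2 + 2 * b * k * (lam i - (∑ j, lam j) / n) +
        k ^ 2 * (lam i - (∑ j, lam j) / n) ^ 2 := by
    rw [meanShift]; ring
  simp only [h, Finset.sum_add_distrib, ← Finset.mul_sum, sum_sub_mean hn, sqDev]
  simp

theorem sum_mul_meanShift {n : ℕ} (hn : n ≠ 0) (lam : Fin n → ℝ) (b k : ℝ) :
    ∑ i, lam i * meanShift n lam b k i = (∑ i, lam i) * b + k * sqDev n lam := by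
  have h (i : Fin n) : lam i * meanShift n lam b k i =
      lam i * b + k * (lam i - (∑ j, lam j) / n) ^ 2 +
        k * ((∑ j, lam j) / n) * (lam i - (∑ j, lam j) / n) := by
    rw [meanShift]; ring
  simp only [h, Finset.sum_add_distrib, ← Finset.mul_sum, ← Finset.sum_mul, sum_sub_mean hn, sqDev]
  simp

theorem sum_nonneg_of_mem_GammaStar_two {n : ℕ} (hn : 2 ≤ n) {lam : Fin n → ℝ}
    (h : lam ∈ GammaStar n 2) : 0 ≤ ∑ i, lam i := by
  have hn' : (2 : ℝ) ≤ n := by exact_mod_cast hn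
  have h1 : (fun _ => 1 : Fin n → ℝ) ∈ Gamma n 2 := by
    rw [mem_Gamma_two]
    simp only [one_pow, Finset.sum_const, Finset.card_univ, Fintype.card_fin, nsmul_eq_mul, mul_one]
    exact ⟨by linarith, by nlinarith⟩
  simpa using h _ h1

theorem sqDev_le_of_mem_GammaStar_two {n : ℕ} (hn : 2 ≤ n) {lam : Fin n → ℝ}
    (h : lam ∈ GammaStar n 2) :
    ((n : ℝ) - 1) / n * sqDev n lam ≤ ((∑ i, lam i) / n) ^ 2 := by
  have hn' : (2 : ℝ) ≤ n := by exact_mod_cast hn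
  have hn0 : n ≠ 0 := by omega
  have hx := sqDev_nonneg n lam
  set a := (∑ i, lam i) / n with ha
  have ha0 : 0 ≤ a := div_nonneg (sum_nonneg_of_mem_GammaStar_two hn h) (by linarith)
  have hL : ∑ i, lam i = n * a := by rw [ha]; field_simp
  set r := √(((n : ℝ) - 1) / n * sqDev n lam) with hr
  have hr2 : r ^ 2 = ((n : ℝ) - 1) / n * sqDev n lam :=
    Real.sq_sqrt (mul_nonneg (div_nonneg (by linarith) (by linarith)) hx)
  have hr3 : n * r ^ 2 = ((n : ℝ) - 1) * sqDev n lam := by rw [hr2]; field_simp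
  by_contra! hlt
  rw [← hr2] at hlt
  have har : a < r := lt_of_pow_lt_pow_left₀ 2 (Real.sqrt_nonneg _) hlt
  have hmem : meanShift n lam (2 * r - a) (-(n - 1)) ∈ Gamma n 2 := by
    rw [mem_Gamma_two, sum_meanShift hn0, sum_meanShift_sq hn0]
    refine ⟨mul_pos (by linarith) (by linarith), ?_⟩
    have h1 : r ^ 2 < (2 * r - a) ^ 2 := by nlinarith
    have h2 : (0 : ℝ) < n * (n - 1) := by nlinarith
    linear_combination (n * (n - 1) : ℝ) * h1 - ((n : ℝ) - 1) * hr3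
  have hneg := h _ hmem
  rw [sum_mul_meanShift hn0, hL] at hneg
  have : 0 ≤ (n : ℝ) * (-(r - a) ^ 2) := by linear_combination hneg + hr3
  nlinarith [mul_pos (by linarith : (0 : ℝ) < n) (pow_pos (sub_pos.2 har) 2)]

theorem sqrt_sub_le_mul_add {a b u v z : ℝ} (ha : 0 ≤ a) (hb : 0 ≤ b) (hu : 0 ≤ u) (hv : 0 ≤ v)
    (hua : u ≤ a ^ 2) (hvb : 1 + v ≤ b ^ 2) (hz : z ^ 2 ≤ u * v) :
    √(a ^ 2 - u) ≤ a * b + z := by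
  set d := √(a ^ 2 - u)
  have hd : 0 ≤ d := Real.sqrt_nonneg _
  have hd2 : d ^ 2 = a ^ 2 - u := Real.sq_sqrt (by linarith)
  have h1 : 2 * d * |z| ≤ d ^ 2 * v + u := by
    refine le_of_sq_le_sq ?_ (by positivity)
    rw [mul_pow, sq_abs]
    nlinarith [sq_nonneg (d ^ 2 * v - u), mul_le_mul_of_nonneg_left hz (sq_nonneg d)]
  have h2 : d + |z| ≤ a * b := by
    refine le_of_sq_le_sq ?_ (by positivity)
    nlinarith [sq_abs z, mul_le_mul_of_nonneg_left hvb (sq_nonneg a)]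
  linarith [neg_abs_le z]

theorem sqrt_le_sum_mul_div {n : ℕ} (hn : 2 ≤ n) {lam mu : Fin n → ℝ}
    (h : lam ∈ GammaStar n 2) (hmu : mu ∈ Gamma n 2) (hrho : 1 ≤ rho n 2 mu) :
    √(((∑ i, lam i) / n) ^ 2 - ((n : ℝ) - 1) / n * sqDev n lam) ≤ (∑ i, lam i * mu i) / n := by
  have hn' : (2 : ℝ) ≤ n := by exact_mod_cast hn
  have hn1 : (0 : ℝ) < n - 1 := by linarith
  have hn0 : n ≠ 0 := by omega
  have hx := sqDev_nonneg n lam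
  have hy := sqDev_nonneg n mu
  have hcs := sq_sum_mul_sub_le hn0 lam mu
  rw [one_le_rho_two hn] at hrho
  have key := sqrt_sub_le_mul_add (a := (∑ i, lam i) / n) (b := (∑ i, mu i) / n)
    (u := ((n : ℝ) - 1) / n * sqDev n lam) (v := sqDev n mu / (n * (n - 1)))
    (z := (∑ i, lam i * mu i - (∑ i, lam i) * (∑ i, mu i) / n) / n)
    (div_nonneg (sum_nonneg_of_mem_GammaStar_two hn h) (by linarith))
    (div_nonneg (mem_Gamma_two.1 hmu).1.le (by linarith)) (by positivity) (by positivity)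
    (sqDev_le_of_mem_GammaStar_two hn h) ?_ ?_
  · refine key.trans_eq ?_
    field_simp
    ring
  · rw [sqDev_eq hn0, ← sub_nonneg]
    have : ((∑ i, mu i) / n) ^ 2 - (1 + (∑ i, mu i ^ 2 - (∑ i, mu i) ^ 2 / n) / (n * (n - 1))) =
        ((∑ i, mu i) ^ 2 - ∑ i, mu i ^ 2 - n * (n - 1)) / (n * (n - 1)) := by
      field_simp
      ring
    rw [this]
    exact div_nonneg (by linarith) (by positivity)
  · rw [div_pow]
    refine (div_le_div_of_nonneg_right hcs (by positivity)).trans_eq ?_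
    field_simp

theorem exists_sum_mul_div_le {n : ℕ} (hn : 2 ≤ n) {lam : Fin n → ℝ} (h : lam ∈ GammaStar n 2)
    {ε : ℝ} (hε : 0 < ε) :
    ∃ mu ∈ Gamma n 2, 1 ≤ rho n 2 mu ∧ (∑ i, lam i * mu i) / n ≤
      √(((∑ i, lam i) / n + ε) ^ 2 - ((n : ℝ) - 1) / n * sqDev n lam) := by
  have hn' : (2 : ℝ) ≤ n := by exact_mod_cast hn
  have hn1 : (0 : ℝ) < n - 1 := by linarith
  have hn0 : n ≠ 0 := by omega
  have hle := sqDev_le_of_mem_GammaStar_two hn h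
  set a := (∑ i, lam i) / n with ha
  have ha0 : 0 ≤ a := div_nonneg (sum_nonneg_of_mem_GammaStar_two hn h) (by linarith)
  have hL : ∑ i, lam i = n * a := by rw [ha]; field_simp
  have hD : 0 < (a + ε) ^ 2 - ((n : ℝ) - 1) / n * sqDev n lam := by nlinarith
  set d := √((a + ε) ^ 2 - ((n : ℝ) - 1) / n * sqDev n lam) with hd
  have hd0 : 0 < d := Real.sqrt_pos.2 hD
  have hd2 : d ^ 2 = (a + ε) ^ 2 - ((n : ℝ) - 1) / n * sqDev n lam := Real.sq_sqrt hD.le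
  have hdev : (n - 1) * sqDev n lam = n * ((a + ε) ^ 2 - d ^ 2) := by rw [hd2]; field_simp; ring
  have hsq : (∑ i, meanShift n lam ((a + ε) / d) (-(n - 1) / d) i) ^ 2 -
      ∑ i, meanShift n lam ((a + ε) / d) (-(n - 1) / d) i ^ 2 = n * (n - 1) := by
    rw [sum_meanShift hn0, sum_meanShift_sq hn0]
    field_simp
    linear_combination (-((n : ℝ) - 1)) * hdev
  refine ⟨meanShift n lam ((a + ε) / d) (-(n - 1) / d), mem_Gamma_two.2 ⟨?_, ?_⟩,
    (one_le_rho_two hn).2 hsq.ge, ?_⟩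
  · rw [sum_meanShift hn0]
    positivity
  · have : (0 : ℝ) < n * (n - 1) := by positivity
    linarith
  · rw [sum_mul_meanShift hn0, hL]
    have : (n * a * ((a + ε) / d) + -(n - 1) / d * sqDev n lam) / n = d - ε * (a + ε) / d := by
      field_simp
      linear_combination -hdev
    rw [this]
    have : 0 ≤ ε * (a + ε) / d := by positivity
    linarith

/-- Formula (1.13) for ρ*_2. -/
theorem rhoStar_two_eq (n : ℕ) (hn : 2 ≤ n) (lam : Fin n → ℝ) (h : lam ∈ GammaStar n 2) :
    rhoStar n 2 lam =
      (1 / Real.sqrt (n : ℝ)) *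
        Real.sqrt ((∑ i, lam i) ^ 2 - ((n : ℝ) - 1) * ∑ i, (lam i) ^ 2) := by
  have hn' : (2 : ℝ) ≤ n := by exact_mod_cast hn
  have hn0 : n ≠ 0 := by omega
  have hform : (1 / √(n : ℝ)) * √((∑ i, lam i) ^ 2 - ((n : ℝ) - 1) * ∑ i, (lam i) ^ 2) =
      √(((∑ i, lam i) / n) ^ 2 - ((n : ℝ) - 1) / n * sqDev n lam) := by
    rw [one_div, ← Real.sqrt_inv, ← Real.sqrt_mul (by positivity), sqDev_eq hn0]
    congr 1
    field_simp
    ring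
  rw [hform, rhoStar]
  apply le_antisymm
  · have hcont : Filter.Tendsto
        (fun ε : ℝ => √(((∑ i, lam i) / n + ε) ^ 2 - ((n : ℝ) - 1) / n * sqDev n lam))
        (nhdsWithin 0 (Ioi 0))
        (nhds √(((∑ i, lam i) / n) ^ 2 - ((n : ℝ) - 1) / n * sqDev n lam)) := by
      have hc : Continuous
          fun ε : ℝ => √(((∑ i, lam i) / n + ε) ^ 2 - ((n : ℝ) - 1) / n * sqDev n lam) := by
        fun_prop
      simpa using (hc.tendsto 0).mono_left nhdsWithin_le_nhds
    refine ge_of_tendsto hcont ?_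
    filter_upwards [self_mem_nhdsWithin] with ε hε
    obtain ⟨mu, hmu, hrho, hle⟩ := exists_sum_mul_div_le hn h hε
    refine le_trans (csInf_le ?_ ⟨mu, hmu, hrho, rfl⟩) hle
    refine ⟨0, ?_⟩
    rintro _ ⟨nu, hnu, -, rfl⟩
    exact div_nonneg (h nu hnu) n.cast_nonneg
  · obtain ⟨mu, hmu, hrho, -⟩ := exists_sum_mul_div_le hn h one_pos
    refine le_csInf ⟨_, mu, hmu, hrho, rfl⟩ ?_
    rintro _ ⟨nu, hnu, hnurho, rfl⟩
    exact sqrt_le_sum_mul_div hn h hnu hnurho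

end
end

section
/- Let n ≥ 2, let k be an integer with 1 ≤ k ≤ n, and let ρ₀, a₀ be positive constants. If A is a real symmetric n×n matrix with λ(A) ∈ Γ*_k, ρ*_k(A) ≥ ρ₀, and every eigenvalue of A at most a₀, then the smallest eigenvalue of A satisfies λ_min(A) ≥ a₀^{1−n} ρ₀^n. In particular all eigenvalues of A lie in the interval [a₀^{1−n}ρ₀^n, a₀]. -/
open MeasureTheory Metric Set Bornology
open scoped ENNReal

noncomputable section

/-- Summing `f` over all `k`-subsets counts every element equally often. -/
lemma sum_powersetCard_sum {ι : Type*} [Fintype ι] {k : ℕ} (hk : 1 ≤ k) (f : ι → ℝ) :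
    ∑ s ∈ Finset.powersetCard k (Finset.univ : Finset ι), ∑ i ∈ s, f i =
      ((Fintype.card ι - 1).choose (k - 1) : ℝ) * ∑ i, f i := by
  classical
  rw [Finset.sum_comm' (t' := Finset.univ)
    (s' := fun i => (Finset.powersetCard k Finset.univ).filter (fun s => {i} ⊆ s))
    (by simp), Finset.mul_sum]
  refine Finset.sum_congr rfl fun i _ => ?_
  rw [Finset.sum_const, Finset.card_filter_powersetCard_subset _ _ _ (Finset.subset_univ _)
    (by simpa using hk)]
  simp

lemma esymm_pos_of_pos {n j : ℕ} (hj : j ≤ n) {mu : Fin n → ℝ} (hmu : ∀ i, 0 < mu i) :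
    0 < esymm n j mu :=
  Finset.sum_pos (fun _ _ => Finset.prod_pos fun i _ => hmu i)
    (Finset.powersetCard_nonempty.2 (by simpa using hj))

/-- Maclaurin's inequality between `S_k` and `S_n`, for positive vectors of product one. -/
lemma choose_le_esymm_of_prod_eq_one {n k : ℕ} (hk : 1 ≤ k) {mu : Fin n → ℝ}
    (hmu : ∀ i, 0 < mu i) (hprod : ∏ i, mu i = 1) : (n.choose k : ℝ) ≤ esymm n k mu := by
  have hlog : ∑ i, Real.log (mu i) = 0 := by
    rw [← Real.log_prod fun i _ => (hmu i).ne', hprod, Real.log_one]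
  calc (n.choose k : ℝ)
      = ∑ s ∈ Finset.powersetCard k (Finset.univ : Finset (Fin n)),
          (∑ i ∈ s, Real.log (mu i) + 1) := by
        simp [Finset.sum_add_distrib, sum_powersetCard_sum hk, hlog]
    _ ≤ esymm n k mu := Finset.sum_le_sum fun s _ => by
        rw [← Real.log_prod fun i _ => (hmu i).ne']
        linarith [Real.log_le_sub_one_of_pos (Finset.prod_pos fun i (_ : i ∈ s) => hmu i)]

lemma one_le_rho_of_prod_eq_one {n k : ℕ} (hk : 1 ≤ k) (hkn : k ≤ n) {mu : Fin n → ℝ}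
    (hmu : ∀ i, 0 < mu i) (hprod : ∏ i, mu i = 1) : 1 ≤ rho n k mu := by
  have hc : (0 : ℝ) < n.choose k := by exact_mod_cast Nat.choose_pos hkn
  exact Real.one_le_rpow ((one_le_div hc).2 (choose_le_esymm_of_prod_eq_one hk hmu hprod))
    (by positivity)

lemma rhoStar_le {n k : ℕ} {lam mu : Fin n → ℝ} (hlam : lam ∈ GammaStar n k)
    (hmu : mu ∈ Gamma n k) (hrho : 1 ≤ rho n k mu) :
    rhoStar n k lam ≤ (∑ i, lam i * mu i) / n := by
  refine csInf_le ⟨0, ?_⟩ ⟨mu, hmu, hrho, rfl⟩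
  rintro t ⟨nu, hnu, -, rfl⟩
  exact div_nonneg (hlam nu hnu) n.cast_nonneg

/-- Vectors in the dual cone have nonnegative entries. -/
lemma nonneg_of_mem_GammaStar {n k : ℕ} (hkn : k ≤ n) {lam : Fin n → ℝ}
    (hlam : lam ∈ GammaStar n k) (i : Fin n) : 0 ≤ lam i := by
  have hcont : Continuous fun ε : ℝ => ∑ j, lam j * ((if j = i then 1 else 0) + ε) := by fun_prop
  have hlim := (hcont.tendsto 0).mono_left (nhdsWithin_le_nhds (s := Set.Ioi 0))
  have h := ge_of_tendsto hlim (b := 0) (by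
    filter_upwards [self_mem_nhdsWithin] with ε hε
    refine hlam _ fun j _ hj => esymm_pos_of_pos (hj.trans hkn) fun l => ?_
    exact add_pos_of_nonneg_of_pos (by split_ifs <;> simp) hε)
  simpa using h

/-- If `ν` is positive and dominates `λ ∈ Γ*_k`, then `ρ*_k(λ)^n ≤ ∏ ν_i`. -/
lemma pow_rhoStar_le_prod {n k : ℕ} (hn : n ≠ 0) (hk : 1 ≤ k) (hkn : k ≤ n)
    {lam nu : Fin n → ℝ} (hlam : lam ∈ GammaStar n k) (hnu : ∀ i, 0 < nu i)
    (hle : ∀ i, lam i ≤ nu i) (hrho : 0 ≤ rhoStar n k lam) :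
    rhoStar n k lam ^ n ≤ ∏ i, nu i := by
  have hP : 0 < ∏ i, nu i := Finset.prod_pos fun i _ => hnu i
  set G : ℝ := (∏ i, nu i) ^ (n⁻¹ : ℝ) with hG
  have hGpos : 0 < G := Real.rpow_pos_of_pos hP _
  have hGn : G ^ n = ∏ i, nu i := Real.rpow_inv_natCast_pow hP.le hn
  have hmu : ∀ i, 0 < G / nu i := fun i => div_pos hGpos (hnu i)
  have hprod : ∏ i, G / nu i = 1 := by
    simp [Finset.prod_div_distrib, hGn, hP.ne']
  have hn0 : (0 : ℝ) < n := by exact_mod_cast Nat.pos_of_ne_zero hn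
  rw [← hGn]
  refine pow_le_pow_left₀ hrho ?_ n
  calc rhoStar n k lam ≤ (∑ i, lam i * (G / nu i)) / n :=
        rhoStar_le hlam (fun j _ hj => esymm_pos_of_pos (hj.trans hkn) hmu)
          (one_le_rho_of_prod_eq_one hk hkn hmu hprod)
    _ ≤ (∑ _i : Fin n, G) / n := by
        gcongr with i
        rw [← mul_div_assoc, div_le_iff₀ (hnu i), mul_comm]
        exact mul_le_mul_of_nonneg_left (hle i) hGpos.le
    _ = G := by simp [hn0.ne']

/-- The dual function is bounded by the geometric mean. -/
lemma pow_rhoStar_le_prod_self {n k : ℕ} (hn : n ≠ 0) (hk : 1 ≤ k) (hkn : k ≤ n)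
    {lam : Fin n → ℝ} (hlam : lam ∈ GammaStar n k) (hrho : 0 ≤ rhoStar n k lam) :
    rhoStar n k lam ^ n ≤ ∏ i, lam i := by
  have hcont : Continuous fun δ : ℝ => ∏ i, (lam i + δ) := by fun_prop
  have hlim := (hcont.tendsto 0).mono_left (nhdsWithin_le_nhds (s := Set.Ioi 0))
  have h := ge_of_tendsto hlim (b := rhoStar n k lam ^ n) (by
    filter_upwards [self_mem_nhdsWithin] with δ hδ
    exact pow_rhoStar_le_prod hn hk hkn hlam
      (fun i => add_pos_of_nonneg_of_pos (nonneg_of_mem_GammaStar hkn hlam i) hδ)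
      (fun i => le_add_of_nonneg_right (le_of_lt hδ)) hrho)
  simpa using h

/-- Uniform ellipticity (4.3): if λ(A) ∈ Γ*_k, ρ*_k(A) ≥ ρ₀ and all eigenvalues are
at most a₀, then all eigenvalues are at least a₀^(1-n) ρ₀^n = ρ₀^n / a₀^(n-1). -/
theorem uniform_ellipticity (n k : ℕ) (hn : 2 ≤ n) (hk1 : 1 ≤ k) (hkn : k ≤ n)
    (ρ₀ a₀ : ℝ) (hρ : 0 < ρ₀) (ha : 0 < a₀)
    (A : Matrix (Fin n) (Fin n) ℝ) (hA : A.IsHermitian)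
    (hG : hA.eigenvalues ∈ GammaStar n k)
    (hrho : ρ₀ ≤ rhoStar n k hA.eigenvalues)
    (hmax : ∀ i, hA.eigenvalues i ≤ a₀) :
    ∀ i, ρ₀ ^ n / a₀ ^ (n - 1) ≤ hA.eigenvalues i ∧ hA.eigenvalues i ≤ a₀ := by
  intro i
  refine ⟨?_, hmax i⟩
  have hnonneg := nonneg_of_mem_GammaStar hkn hG
  have hi : ∏ j ∈ Finset.univ.erase i, hA.eigenvalues j ≤ a₀ ^ (n - 1) := by
    refine (Finset.prod_le_prod (fun j _ => hnonneg j) fun j _ => hmax j).trans_eq ?_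
    simp
  rw [div_le_iff₀ (pow_pos ha _)]
  calc ρ₀ ^ n ≤ rhoStar n k hA.eigenvalues ^ n := pow_le_pow_left₀ hρ.le hrho n
    _ ≤ ∏ j, hA.eigenvalues j :=
        pow_rhoStar_le_prod_self (by omega) hk1 hkn hG (hρ.le.trans hrho)
    _ = hA.eigenvalues i * ∏ j ∈ Finset.univ.erase i, hA.eigenvalues j :=
        (Finset.mul_prod_erase _ _ (Finset.mem_univ i)).symm
    _ ≤ hA.eigenvalues i * a₀ ^ (n - 1) := mul_le_mul_of_nonneg_left hi (hnonneg i)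

end
end
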